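/- arXiv:1302.5506 — 5 statements merged into one kernel-verified Lean document; each statement's English description precedes it below -/
import Mathlib

section
/- Let n ≥ 1, let m, r be natural numbers with r ≤ m, and let U be a nonempty open subset of ℝⁿ. Then every morphism of sheaves u : C^m → C^r over U is given by a unique differential operator of order ≤ m − r with coefficients of class C^r: there exists a unique family of functions a_α ∈ C^r(U), indexed by the multi-indices α with |α| ≤ m − r, such that for every open V ⊆ U, every φ ∈ C^m(V) and every x ∈ V one has u_V(φ)(x) = Σ_{|α| ≤ m−r} a_α(x) · (∂^α φ)(x). -/
open scoped BigOperators

/-- The partial derivative in the `i`-th coordinate direction. -/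
noncomputable def pderivE (n : ℕ) (i : Fin n) (f : EuclideanSpace ℝ (Fin n) → ℝ) :
    EuclideanSpace ℝ (Fin n) → ℝ :=
  fun x => fderiv ℝ f x (EuclideanSpace.single i 1)

/-- The iterated partial derivative `∂^α` for a multi-index `α : Fin n → ℕ`. -/
noncomputable def partialD (n : ℕ) (α : Fin n → ℕ) (f : EuclideanSpace ℝ (Fin n) → ℝ) :
    EuclideanSpace ℝ (Fin n) → ℝ :=
  (List.finRange n).foldr (fun i g => (pderivE n i)^[α i] g) f

/-- The finset of multi-indices `α : Fin n → ℕ` of length `|α| = ∑ i, α i ≤ k`. -/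
def multiIdx (n k : ℕ) : Finset (Fin n → ℕ) :=
  (Finset.Iic fun _ : Fin n => k).filter fun α => (∑ i, α i) ≤ k

/-- A morphism of sheaves `C^m → C^r` over the open set `U ⊆ ℝⁿ`:  a family of
`ℝ`-linear maps `C^m(V) → C^r(V)`, for open `V ⊆ U`, commuting with restriction.
Sections of `C^k` over `V` are represented by total functions that are `C^k` on `V`;
`restrict` encodes both compatibility with restriction and the fact that `app V f`
only depends on `f|_V`. -/
structure SheafHom (n m r : ℕ) (U : Set (EuclideanSpace ℝ (Fin n))) where
  app : Set (EuclideanSpace ℝ (Fin n)) → (EuclideanSpace ℝ (Fin n) → ℝ) →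
    (EuclideanSpace ℝ (Fin n) → ℝ)
  map_contDiffOn : ∀ V, V ⊆ U → IsOpen V → ∀ f, ContDiffOn ℝ (m : ℕ∞) f V →
    ContDiffOn ℝ (r : ℕ∞) (app V f) V
  map_add : ∀ V, V ⊆ U → IsOpen V → ∀ f g, ContDiffOn ℝ (m : ℕ∞) f V →
    ContDiffOn ℝ (m : ℕ∞) g V → ∀ x ∈ V, app V (f + g) x = app V f x + app V g x
  map_smul : ∀ V, V ⊆ U → IsOpen V → ∀ (c : ℝ) f, ContDiffOn ℝ (m : ℕ∞) f V →
    ∀ x ∈ V, app V (c • f) x = c * app V f x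
  restrict : ∀ V, V ⊆ U → IsOpen V → ∀ W, W ⊆ V → IsOpen W →
    ∀ f g, ContDiffOn ℝ (m : ℕ∞) f V → ContDiffOn ℝ (m : ℕ∞) g W →
    (∀ x ∈ W, f x = g x) → ∀ x ∈ W, app V f x = app W g x

open Filter Topology Asymptotics
open scoped ContDiff

theorem pt_flat_contDiff {E : Type} [NormedAddCommGroup E] [NormedSpace ℝ E] (m : ℕ) :
    ∀ {F : Type} [NormedAddCommGroup F] [NormedSpace ℝ F] (f : E → F),
    ContDiffOn ℝ (m : ℕ) f {0}ᶜ → f 0 = 0 →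
    (∀ k ≤ m, (iteratedFDeriv ℝ k f) =o[𝓝[≠] (0:E)] (fun y : E => ‖y‖ ^ (m - k))) →
    ContDiff ℝ (m : ℕ) f := by
  induction m with
  | zero =>
    intro F _ _ f hf h0 h
    have h1 : f =o[𝓝[≠] (0:E)] (fun y : E => (1:ℝ)) := by
      have := (h 0 le_rfl).norm_left
      simp only [norm_iteratedFDeriv_zero, Nat.sub_self, pow_zero] at this
      exact this.of_norm_left
    rw [isLittleO_one_iff] at h1
    rw [Nat.cast_zero, contDiff_zero, continuous_iff_continuousAt]
    intro y
    by_cases hy : y = 0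
    · subst hy
      rw [continuousAt_iff_punctured_nhds, h0]
      exact h1
    · exact hf.continuousOn.continuousAt (isOpen_compl_singleton.mem_nhds hy)
  | succ m ih =>
    intro F _ _ f hf h0 h
    have h1 : f =o[𝓝 (0:E)] (fun y : E => ‖y‖ ^ (m + 1)) := by
      have := (h 0 (Nat.zero_le _)).norm_left
      simp only [norm_iteratedFDeriv_zero, Nat.sub_zero] at this
      have := this.of_norm_left
      rw [isLittleO_iff] at this ⊢
      intro c hc
      filter_upwards [eventually_nhdsWithin_iff.1 (this hc)] with y hy
      by_cases hy0 : y = 0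
      · subst hy0; simp [h0]
      · exact hy hy0
    have h2 : HasFDerivAt f (0 : E →L[ℝ] F) 0 := by
      rw [hasFDerivAt_iff_isLittleO_nhds_zero]
      simp only [zero_add, h0, sub_zero, _root_.zero_apply]
      refine h1.trans_isBigO ?_
      have : (fun y : E => ‖y‖ ^ (m+1)) =O[𝓝 0] (fun y : E => ‖y‖ ^ 1) := by
        apply IsBigO.of_bound 1
        filter_upwards [Metric.ball_mem_nhds (0:E) one_pos] with y hy
        simp only [mem_ball_zero_iff] at hy
        simp only [norm_pow, norm_norm, one_mul]
        exact pow_le_pow_of_le_one (norm_nonneg _) hy.le (by omega)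
      simp only [pow_one] at this
      exact this.of_norm_right
    have hc := (contDiffOn_succ_iff_fderiv_of_isOpen (n := (m:ℕ)) isOpen_compl_singleton).1 (by exact_mod_cast hf)
    have h3 := ih (fderiv ℝ f) hc.2.2 h2.fderiv (fun k hk => by
      have := (h (k+1) (by omega)).norm_left
      simp only [← norm_iteratedFDeriv_fderiv, Nat.add_sub_add_right] at this
      exact this.of_norm_left)
    push_cast
    rw [contDiff_succ_iff_fderiv]
    refine ⟨fun y => ?_, by simp, h3⟩
    by_cases hy : y = 0
    · subst hy; exact h2.differentiableAt
    · exact (hc.1 y hy).differentiableAt (isOpen_compl_singleton.mem_nhds hy)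

theorem pt_flat_isLittleO {E : Type} [NormedAddCommGroup E] [NormedSpace ℝ E] (m : ℕ) :
    ∀ {F : Type} [NormedAddCommGroup F] [NormedSpace ℝ F] (f : E → F),
    ContDiff ℝ (m : ℕ) f → 
    (∀ k ≤ m, iteratedFDeriv ℝ k f 0 = 0) →
    (∀ k ≤ m, (iteratedFDeriv ℝ k f) =o[𝓝 (0:E)] (fun y : E => ‖y‖ ^ (m - k))) := by
  induction m with
  | zero =>
    intro F _ _ f hf h k hk
    obtain rfl : k = 0 := by omega
    simp only [Nat.sub_self, pow_zero]
    rw [isLittleO_one_iff, ← h 0 le_rfl]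
    exact (hf.continuous_iteratedFDeriv (m := 0) (by simp)).continuousAt
  | succ m ih =>
    intro F _ _ f hf h
    have hc := (contDiff_succ_iff_fderiv (n := (m:ℕ))).1 (by exact_mod_cast hf)
    have h1 := ih (fderiv ℝ f) hc.2.2 (fun k hk => by
      rw [← norm_eq_zero, norm_iteratedFDeriv_fderiv, h (k+1) (by omega), norm_zero])
    intro k hk
    rcases k with _ | k
    · have h2 := (h1 0 (Nat.zero_le _)).norm_left
      simp only [norm_iteratedFDeriv_zero, Nat.sub_zero] at h2
      have h0 : f 0 = 0 := by
        rw [← norm_eq_zero, ← norm_iteratedFDeriv_zero (𝕜 := ℝ), h 0 (by omega), norm_zero]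
      refine IsLittleO.of_norm_left ?_
      simp only [norm_iteratedFDeriv_zero, Nat.sub_zero]
      refine IsLittleO.norm_left ?_
      rw [isLittleO_iff] at h2 ⊢
      intro c hc'
      obtain ⟨δ, hδ, hb⟩ := Metric.eventually_nhds_iff_ball.1 (h2 hc')
      filter_upwards [Metric.ball_mem_nhds (0:E) hδ] with y hy
      have := (convex_closedBall (0:E) ‖y‖).norm_image_sub_le_of_norm_fderiv_le (f := f) (C := c * ‖y‖ ^ m) (x := 0) (y := y) (𝕜 := ℝ)
        (fun z _ => hc.1 z) (fun z hz => by
          simp only [mem_closedBall_zero_iff] at hz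
          have h3 := hb z (by simp at hy ⊢; linarith)
          simp only [norm_norm, norm_pow] at h3
          refine h3.trans ?_
          gcongr) (by simp) (by simp)
      simp only [h0, sub_zero] at this
      simp only [norm_pow, norm_norm]
      rw [pow_succ]; linarith
    · have := (h1 k (by omega)).norm_left
      simp only [norm_iteratedFDeriv_fderiv] at this
      simp only [Nat.add_sub_add_right]
      exact this.of_norm_left

theorem pt_homog_bound {E : Type} [NormedAddCommGroup E] [NormedSpace ℝ E] [FiniteDimensional ℝ E]
    (χ : E → ℝ) (k : ℕ) (hχ : ContDiffOn ℝ (k : ℕ) χ {0}ᶜ)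
    (hh : ∀ t : ℝ, 0 < t → ∀ y, χ (t • y) = χ y) :
    ∃ C : ℝ, ∀ y : E, y ≠ 0 → ‖y‖ ^ k * ‖iteratedFDeriv ℝ k χ y‖ ≤ C := by
  have hcont : ContinuousOn (iteratedFDeriv ℝ k χ) {0}ᶜ := by
    have h1 := hχ.continuousOn_iteratedFDerivWithin (m := k) le_rfl
      isOpen_compl_singleton.uniqueDiffOn
    exact h1.congr (fun y hy => (iteratedFDerivWithin_of_isOpen k isOpen_compl_singleton hy).symm)
  have hS : IsCompact (Metric.sphere (0:E) 1) := isCompact_sphere _ _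
  obtain ⟨C, hC⟩ := hS.exists_bound_of_continuousOn (f := iteratedFDeriv ℝ k χ)
    (hcont.mono (fun y hy => by
      rintro (rfl : y = 0); simp at hy))
  refine ⟨C, fun y hy => ?_⟩
  have hy' : 0 < ‖y‖ := norm_pos_iff.2 hy
  set g : E ≃L[ℝ] E := ContinuousLinearEquiv.smulLeft (Units.mk0 ‖y‖ hy'.ne') with hg
  have hgz : ∀ z, g z = ‖y‖ • z := fun z => rfl
  have hcomp : χ ∘ g = χ := by
    funext z; simp only [Function.comp, hgz]; exact hh _ hy' z
  have h2 := g.iteratedFDerivWithin_comp_right χ (uniqueDiffOn_univ) (x := ‖y‖⁻¹ • y)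
    (Set.mem_univ _) k
  rw [hcomp, Set.preimage_univ] at h2
  simp only [iteratedFDerivWithin_univ] at h2
  have h3 : g (‖y‖⁻¹ • y) = y := by rw [hgz, smul_inv_smul₀ hy'.ne']
  rw [h3] at h2
  have h4 : iteratedFDeriv ℝ k χ (‖y‖⁻¹ • y) = ‖y‖ ^ k • iteratedFDeriv ℝ k χ y := by
    rw [h2]; ext v
    simp only [ContinuousMultilinearMap.compContinuousLinearMap_apply,
      _root_.smul_apply]
    have := (iteratedFDeriv ℝ k χ y).map_smul_univ (fun _ => ‖y‖) v
    simp only [Finset.prod_const, Finset.card_univ, Fintype.card_fin] at this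
    rw [← this]; rfl
  have h5 := hC (‖y‖⁻¹ • y) (by simp [norm_smul, hy'.ne'])
  rw [h4, norm_smul] at h5
  simpa using h5

theorem pt_mul_flat {E : Type} [NormedAddCommGroup E] [NormedSpace ℝ E] [FiniteDimensional ℝ E]
    (χ : E → ℝ) (m : ℕ) (hχ : ContDiffOn ℝ (m : ℕ) χ {0}ᶜ)
    (hh : ∀ t : ℝ, 0 < t → ∀ y, χ (t • y) = χ y) (f : E → ℝ) (hf : ContDiff ℝ (m : ℕ) f)
    (h0 : ∀ k ≤ m, iteratedFDeriv ℝ k f 0 = 0) : ContDiff ℝ (m : ℕ) (fun y => χ y * f y) := by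
  have hfo := pt_flat_isLittleO m f hf h0
  have hf0 : f 0 = 0 := by
    rw [← norm_eq_zero, ← norm_iteratedFDeriv_zero (𝕜 := ℝ), h0 0 (by omega), norm_zero]
  refine pt_flat_contDiff m _ (hχ.mul hf.contDiffOn) (by simp [hf0]) ?_
  intro k hk
  have hb : ∀ y : E, y ≠ 0 → ‖iteratedFDeriv ℝ k (fun y => χ y * f y) y‖ ≤
      ∑ i ∈ Finset.range (k + 1), (k.choose i : ℝ) * ‖iteratedFDeriv ℝ i χ y‖ *
        ‖iteratedFDeriv ℝ (k - i) f y‖ := by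
    intro y hy
    have := norm_iteratedFDerivWithin_mul_le hχ (hf.contDiffOn (s := {0}ᶜ))
      isOpen_compl_singleton.uniqueDiffOn (x := y) hy (n := k) (by exact_mod_cast hk)
    simpa only [iteratedFDerivWithin_of_isOpen _ isOpen_compl_singleton
      (show y ∈ ({0}ᶜ : Set E) from hy)] using this
  have hsum : (fun y => ∑ i ∈ Finset.range (k + 1), (k.choose i : ℝ) * ‖iteratedFDeriv ℝ i χ y‖ *
        ‖iteratedFDeriv ℝ (k - i) f y‖) =o[𝓝[≠] (0:E)] (fun y : E => ‖y‖ ^ (m - k)) := by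
    apply IsLittleO.fun_sum
    intro i hi
    have hi : i ≤ k := by simp at hi; omega
    obtain ⟨C, hC⟩ := pt_homog_bound χ i (hχ.of_le (by exact_mod_cast hi.trans hk)) hh
    have h1 : (fun y => (k.choose i : ℝ) * ‖iteratedFDeriv ℝ i χ y‖) =O[𝓝[≠] (0:E)]
        (fun y : E => (‖y‖ ^ i)⁻¹) := by
      apply IsBigO.const_mul_left
      apply IsBigO.of_bound C
      filter_upwards [self_mem_nhdsWithin] with y hy
      have hy' : 0 < ‖y‖ ^ i := pow_pos (norm_pos_iff.2 hy) _
      simp only [norm_norm, norm_inv, norm_pow]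
      rw [← div_eq_mul_inv, le_div_iff₀ hy', mul_comm]
      exact hC y hy
    have h2 := ((hfo (k - i) (by omega)).mono (nhdsWithin_le_nhds (s := {0}ᶜ))).norm_left
    refine (h1.mul_isLittleO h2).congr' EventuallyEq.rfl ?_
    filter_upwards [self_mem_nhdsWithin] with y hy
    have hy' : 0 < ‖y‖ := norm_pos_iff.2 hy
    rw [show m - (k - i) = i + (m - k) by omega, pow_add]
    field_simp
  refine IsBigO.trans_isLittleO (IsBigO.of_bound 1 ?_) hsum
  filter_upwards [self_mem_nhdsWithin] with y hy
  rw [one_mul]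
  exact (hb y hy).trans (le_abs_self _)

theorem pt_cone {E : Type} [NormedAddCommGroup E] [InnerProductSpace ℝ E] [FiniteDimensional ℝ E]
    (m : ℕ) (e : E) (f : E → ℝ) (hf : ContDiff ℝ (m : ℕ) f)
    (h0 : ∀ k ≤ m, iteratedFDeriv ℝ k f 0 = 0) :
    ∃ ψ : E → ℝ, ContDiff ℝ (m : ℕ) ψ ∧ (∀ y, ‖y‖ < 2 * inner ℝ e y → ψ y = f y) ∧
      ∀ y, inner ℝ e y < 0 → ψ y = 0 := by
  refine ⟨fun y => Real.smoothTransition (2 * inner ℝ e y / ‖y‖) * f y, ?_, ?_, ?_⟩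
  · refine pt_mul_flat (fun y => Real.smoothTransition (2 * inner ℝ e y / ‖y‖)) m ?_ ?_ f hf h0
    · intro y hy
      apply ContDiffAt.contDiffWithinAt
      refine (Real.smoothTransition.contDiffAt (n := (m : ℕ∞))).comp y ?_
      exact ((contDiffAt_const.mul (contDiffAt_const.inner ℝ contDiffAt_id))).div
        (contDiffAt_id.norm ℝ hy) (by simpa using hy)
    · intro t ht y
      simp only [inner_smul_right, norm_smul, Real.norm_eq_abs, abs_of_pos ht]
      congr 1
      rw [show 2 * (t * inner ℝ e y) = t * (2 * inner ℝ e y) by ring,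
        mul_div_mul_left _ _ ht.ne']
  · intro y hy
    have hy0 : 0 < ‖y‖ := by
      rw [norm_pos_iff]; rintro rfl; simp at hy
    simp only
    rw [Real.smoothTransition.one_of_one_le, one_mul]
    rw [le_div_iff₀ hy0]; linarith
  · intro y hy
    simp only
    rw [Real.smoothTransition.zero_of_nonpos, zero_mul]
    exact div_nonpos_of_nonpos_of_nonneg (by linarith) (norm_nonneg _)

theorem pd_contDiff {n : ℕ} (i : Fin n) (k : ℕ) (f : EuclideanSpace ℝ (Fin n) → ℝ)
    (hf : ContDiff ℝ (k + 1 : ℕ) f) : ContDiff ℝ (k : ℕ) (pderivE n i f) := by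
  unfold pderivE
  exact (hf.fderiv_right (m := (k : ℕ)) (by push_cast; exact le_rfl)).clm_apply contDiff_const

theorem pd_iter_contDiff {n : ℕ} (i : Fin n) (k j : ℕ) : ∀ (f : EuclideanSpace ℝ (Fin n) → ℝ)
    (_ : ContDiff ℝ (k + j : ℕ) f), ContDiff ℝ (k : ℕ) ((pderivE n i)^[j] f) := by
  induction j with
  | zero => intro f hf; simpa using hf
  | succ j ih =>
    intro f hf
    rw [Function.iterate_succ_apply]
    exact ih _ (pd_contDiff i (k + j) f hf)

theorem pdl_contDiff {n : ℕ} (α : Fin n → ℕ) (l : List (Fin n)) (f : EuclideanSpace ℝ (Fin n) → ℝ) :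
    ∀ (k : ℕ) (_ : ContDiff ℝ (k + (l.map α).sum : ℕ) f),
    ContDiff ℝ (k : ℕ) (l.foldr (fun i g => (pderivE n i)^[α i] g) f) := by
  induction l with
  | nil => intro k hf; simpa using hf
  | cons i l ih =>
    intro k hf
    simp only [List.foldr_cons]
    apply pd_iter_contDiff
    apply ih
    simpa [add_assoc] using hf

theorem pd_sum_finRange {n : ℕ} (α : Fin n → ℕ) : ((List.finRange n).map α).sum = ∑ i, α i := by
  simp [Fin.sum_univ_def]

theorem partialD_contDiff {n : ℕ} (α : Fin n → ℕ) (k : ℕ) (f : EuclideanSpace ℝ (Fin n) → ℝ)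
    (hf : ContDiff ℝ (k + ∑ i, α i : ℕ) f) : ContDiff ℝ (k : ℕ) (partialD n α f) := by
  unfold partialD
  apply pdl_contDiff
  rwa [pd_sum_finRange]

theorem pd_congr {n : ℕ} (i : Fin n) {f g : EuclideanSpace ℝ (Fin n) → ℝ}
    {x : EuclideanSpace ℝ (Fin n)} (h : f =ᶠ[𝓝 x] g) : pderivE n i f =ᶠ[𝓝 x] pderivE n i g := by
  filter_upwards [h.fderiv (𝕜 := ℝ)] with y hy
  simp only [pderivE, hy]

theorem pd_iter_congr {n : ℕ} (i : Fin n) (j : ℕ) {f g : EuclideanSpace ℝ (Fin n) → ℝ}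
    {x : EuclideanSpace ℝ (Fin n)} (h : f =ᶠ[𝓝 x] g) :
    (pderivE n i)^[j] f =ᶠ[𝓝 x] (pderivE n i)^[j] g := by
  induction j with
  | zero => exact h
  | succ j ih =>
    rw [Function.iterate_succ_apply', Function.iterate_succ_apply']
    exact pd_congr i ih

theorem partialD_congr {n : ℕ} (α : Fin n → ℕ) {f g : EuclideanSpace ℝ (Fin n) → ℝ}
    {x : EuclideanSpace ℝ (Fin n)} (h : f =ᶠ[𝓝 x] g) :
    partialD n α f =ᶠ[𝓝 x] partialD n α g := by
  unfold partialD
  induction List.finRange n with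
  | nil => exact h
  | cons i l ih =>
    simp only [List.foldr_cons]
    exact pd_iter_congr i _ ih

theorem pd_lin {n : ℕ} (i : Fin n) (c d : ℝ) {f g : EuclideanSpace ℝ (Fin n) → ℝ}
    (hf : ContDiff ℝ (1 : ℕ) f) (hg : ContDiff ℝ (1 : ℕ) g) :
    pderivE n i (c • f + d • g) = c • pderivE n i f + d • pderivE n i g := by
  have hf' : Differentiable ℝ f := hf.differentiable (by simp)
  have hg' : Differentiable ℝ g := hg.differentiable (by simp)
  funext y
  simp only [pderivE]
  rw [fderiv_add ((hf' y).const_smul c) ((hg' y).const_smul d), fderiv_const_smul (hf' y),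
    fderiv_const_smul (hg' y)]
  simp [pderivE]

theorem pd_iter_lin {n : ℕ} (i : Fin n) (c d : ℝ) (j : ℕ) : ∀ {f g : EuclideanSpace ℝ (Fin n) → ℝ}
    (_ : ContDiff ℝ (j : ℕ) f) (_ : ContDiff ℝ (j : ℕ) g),
    (pderivE n i)^[j] (c • f + d • g) = c • (pderivE n i)^[j] f + d • (pderivE n i)^[j] g := by
  induction j with
  | zero => intros; rfl
  | succ j ih =>
    intro f g hf hg
    simp only [Function.iterate_succ_apply]
    rw [pd_lin i c d (hf.of_le (by simp)) (hg.of_le (by simp)), ih (pd_contDiff i j f hf)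
      (pd_contDiff i j g hg)]

theorem partialD_lin {n : ℕ} (α : Fin n → ℕ) (c d : ℝ) {f g : EuclideanSpace ℝ (Fin n) → ℝ}
    (hf : ContDiff ℝ (∑ i, α i : ℕ) f) (hg : ContDiff ℝ (∑ i, α i : ℕ) g) :
    partialD n α (c • f + d • g) = c • partialD n α f + d • partialD n α g := by
  unfold partialD
  rw [← pd_sum_finRange] at hf hg
  generalize List.finRange n = l at hf hg ⊢
  induction l with
  | nil => rfl
  | cons i l ih =>
    simp only [List.foldr_cons]
    simp only [List.map_cons, List.sum_cons] at hf hg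
    rw [ih (hf.of_le (by exact_mod_cast Nat.le_add_left _ _))
      (hg.of_le (by exact_mod_cast Nat.le_add_left _ _))]
    exact pd_iter_lin i c d _ (pdl_contDiff α l f _ hf) (pdl_contDiff α l g _ hg)

theorem partialD_zero {n : ℕ} (α : Fin n → ℕ) : partialD n α 0 = 0 := by
  have h := partialD_lin α 0 0 (f := 0) (g := 0) contDiff_const contDiff_const
  simpa using h

theorem partialD_sum {n : ℕ} (α : Fin n → ℕ) {ι : Type} (s : Finset ι) (c : ι → ℝ)
    (f : ι → EuclideanSpace ℝ (Fin n) → ℝ)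
    (hf : ∀ j, ContDiff ℝ (∑ i, α i : ℕ) (f j)) :
    partialD n α (∑ j ∈ s, c j • f j) = ∑ j ∈ s, c j • partialD n α (f j) := by
  classical
  induction s using Finset.induction_on with
  | empty => simp [partialD_zero]
  | insert j s hj ih =>
    rw [Finset.sum_insert hj, Finset.sum_insert hj, ← ih]
    have := partialD_lin α (c j) 1 (hf j) (g := ∑ j ∈ s, c j • f j)
      (by
        have : (∑ j ∈ s, c j • f j) = fun y => ∑ j ∈ s, (c j • f j) y := by
          funext y; simp
        rw [this]
        exact ContDiff.sum fun j _ => (hf j).const_smul (c j))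
    simpa using this

theorem pd_comm {n : ℕ} (i j : Fin n) {f : EuclideanSpace ℝ (Fin n) → ℝ}
    (hf : ContDiff ℝ (2 : ℕ) f) : pderivE n i (pderivE n j f) = pderivE n j (pderivE n i f) := by
  have hd : Differentiable ℝ (fderiv ℝ f) :=
    (hf.fderiv_right (m := (1 : ℕ)) (by norm_num)).differentiable (by simp)
  have key : ∀ (v w : EuclideanSpace ℝ (Fin n)) y,
      fderiv ℝ (fun z => fderiv ℝ f z v) y w = fderiv ℝ (fderiv ℝ f) y w v := by
    intro v w y
    rw [fderiv_clm_apply (hd y) (differentiableAt_const v)]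
    simp
  funext y
  change fderiv ℝ (fun z => fderiv ℝ f z _) y _ = fderiv ℝ (fun z => fderiv ℝ f z _) y _
  rw [key, key]
  exact (hf.contDiffAt.isSymmSndFDerivAt (by simp)) _ _

theorem pd_iter_comm {n : ℕ} (i j : Fin n) (k : ℕ) : ∀ {f : EuclideanSpace ℝ (Fin n) → ℝ}
    (_ : ContDiff ℝ (k + 1 : ℕ) f),
    (pderivE n i)^[k] (pderivE n j f) = pderivE n j ((pderivE n i)^[k] f) := by
  induction k with
  | zero => intros; rfl
  | succ k ih =>
    intro f hf
    simp only [Function.iterate_succ_apply]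
    rw [pd_comm i j (hf.of_le (by exact_mod_cast (by omega : 2 ≤ k + 1 + 1))),
      ih (pd_contDiff i _ f hf)]

theorem pdl_comm {n : ℕ} (α : Fin n → ℕ) (j : Fin n) (l : List (Fin n))
    {f : EuclideanSpace ℝ (Fin n) → ℝ} (hf : ContDiff ℝ ((l.map α).sum + 1 : ℕ) f) :
    l.foldr (fun i g => (pderivE n i)^[α i] g) (pderivE n j f) =
      pderivE n j (l.foldr (fun i g => (pderivE n i)^[α i] g) f) := by
  induction l with
  | nil => rfl
  | cons i l ih =>
    simp only [List.foldr_cons]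
    simp only [List.map_cons, List.sum_cons] at hf
    rw [ih (hf.of_le (by exact_mod_cast (by omega)))]
    apply pd_iter_comm
    apply pdl_contDiff
    convert hf using 2
    exact_mod_cast (by omega)

theorem pdl_succ {n : ℕ} (α : Fin n → ℕ) (j : Fin n) (l : List (Fin n)) (hl : l.Nodup)
    {f : EuclideanSpace ℝ (Fin n) → ℝ} (hf : ContDiff ℝ ((l.map α).sum + 1 : ℕ) f) :
    l.foldr (fun i g => (pderivE n i)^[(α + Pi.single j 1 : Fin n → ℕ) i] g) f =
     if j ∈ l then l.foldr (fun i g => (pderivE n i)^[α i] g) (pderivE n j f) else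
     l.foldr (fun i g => (pderivE n i)^[α i] g) f := by
  induction l with
  | nil => rfl
  | cons i l ih =>
    simp only [List.map_cons, List.sum_cons] at hf
    have hf' : ContDiff ℝ ((l.map α).sum + 1 : ℕ) f := hf.of_le (by exact_mod_cast (by omega))
    rw [List.nodup_cons] at hl
    simp only [List.foldr_cons]
    rw [ih hl.2 hf']
    by_cases hij : i = j
    · subst hij
      simp only [hl.1, if_false, List.mem_cons, true_or, if_true, Pi.add_apply, Pi.single_eq_same]
      rw [Function.iterate_succ_apply, pdl_comm α i l hf']
    · have h1 : (α + Pi.single j 1 : Fin n → ℕ) i = α i := by simp [hij]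
      have h2 : j ∈ i :: l ↔ j ∈ l := by simp [Ne.symm hij]
      rw [h1]
      simp only [h2]
      split_ifs <;> rfl

theorem partialD_succ {n : ℕ} (α : Fin n → ℕ) (j : Fin n)
    {f : EuclideanSpace ℝ (Fin n) → ℝ} (hf : ContDiff ℝ (∑ i, α i + 1 : ℕ) f) :
    partialD n (α + Pi.single j 1) f = partialD n α (pderivE n j f) := by
  unfold partialD
  rw [pdl_succ α j _ (List.nodup_finRange n) (by rwa [pd_sum_finRange])]
  simp

theorem partialD_zero_idx {n : ℕ} (f : EuclideanSpace ℝ (Fin n) → ℝ) : partialD n 0 f = f := by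
  unfold partialD
  induction List.finRange n with
  | nil => rfl
  | cons i l ih => simp only [List.foldr_cons]; rw [ih]; rfl

theorem flat_of_partialD {n : ℕ} (x : EuclideanSpace ℝ (Fin n)) (k : ℕ) :
    ∀ (f : EuclideanSpace ℝ (Fin n) → ℝ) (_ : ContDiff ℝ (k : ℕ) f)
    (_ : ∀ α : Fin n → ℕ, ∑ i, α i = k → partialD n α f x = 0), iteratedFDeriv ℝ k f x = 0 := by
  induction k with
  | zero =>
    intro f hf h
    rw [← norm_eq_zero, norm_iteratedFDeriv_zero, ← partialD_zero_idx f, h 0 (by simp), norm_zero]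
  | succ k ih =>
    intro f hf h
    have hd : ContDiff ℝ (k : ℕ) (fderiv ℝ f) := hf.fderiv_right (m := (k : ℕ)) (by push_cast; rfl)
    apply ContinuousMultilinearMap.toMultilinearMap_injective
    apply Module.Basis.ext_multilinear (fun _ => (EuclideanSpace.basisFun (Fin n) ℝ).toBasis)
    intro v
    simp only [ContinuousMultilinearMap.coe_coe, OrthonormalBasis.coe_toBasis]
    rw [iteratedFDeriv_succ_apply_right]
    have h1 := (ContinuousLinearMap.apply ℝ ℝ (EuclideanSpace.single (v (Fin.last k)) (1:ℝ))).iteratedFDeriv_comp_left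
      (hd.contDiffAt (x := x)) (i := k) le_rfl
    have h2 := ih (pderivE n (v (Fin.last k)) f) (pd_contDiff _ _ _ hf) (fun α hα => by
      rw [← partialD_succ α _ (by rwa [hα])]
      apply h
      simp [Finset.sum_add_distrib, hα])
    have h3 : (ContinuousLinearMap.apply ℝ ℝ (EuclideanSpace.single (v (Fin.last k)) (1:ℝ))) ∘ fderiv ℝ f
      = pderivE n (v (Fin.last k)) f := rfl
    rw [h3, h2] at h1
    have h4 := congrArg (fun q => q (Fin.init fun i => EuclideanSpace.basisFun (Fin n) ℝ (v i))) h1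
    simp only [ContinuousLinearMap.compContinuousMultilinearMap_coe, Function.comp] at h4
    rw [EuclideanSpace.basisFun_apply]
    exact h4.symm

theorem pd_prod {n : ℕ} (i : Fin n) (f : Fin n → ℝ → ℝ) (hf : ∀ j, Differentiable ℝ (f j)) :
    pderivE n i (fun y => ∏ j, f j (y j)) = fun y => ∏ j, Function.update f i (deriv (f i)) j (y j) := by
  funext y
  simp only [pderivE]
  have h1 : ∀ j ∈ Finset.univ, HasFDerivAt (fun y : EuclideanSpace ℝ (Fin n) => f j (y j))
      (deriv (f j) (y j) • (EuclideanSpace.proj j : EuclideanSpace ℝ (Fin n) →L[ℝ] ℝ)) y := by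
    intro j _
    exact ((hf j) (y j)).hasDerivAt.comp_hasFDerivAt y
      (EuclideanSpace.proj j : EuclideanSpace ℝ (Fin n) →L[ℝ] ℝ).hasFDerivAt
  have h2 := HasFDerivAt.finsetProd h1
  rw [h2.fderiv]
  simp only [_root_.sum_apply, _root_.smul_apply]
  rw [Finset.sum_eq_single i]
  · rw [← Finset.mul_prod_erase Finset.univ _ (Finset.mem_univ i)]
    simp only [Function.update_self]
    rw [mul_comm]
    simp
    left
    apply Finset.prod_congr rfl
    intro j hj
    rw [Function.update_of_ne (by simpa using hj)]
  · intro j _ hj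
    simp [hj]
  · simp

theorem pd_iter_prod {n : ℕ} (i : Fin n) (k : ℕ) : ∀ (f : Fin n → ℝ → ℝ) (_ : ∀ j, ContDiff ℝ ∞ (f j)),
    (pderivE n i)^[k] (fun y => ∏ j, f j (y j)) =
      fun y => ∏ j, Function.update f i (deriv^[k] (f i)) j (y j) := by
  induction k with
  | zero => intro f hf; simp
  | succ k ih =>
    intro f hf
    rw [Function.iterate_succ_apply, pd_prod i f (fun j => (hf j).differentiable (by simp)), ih]
    · simp
    · intro j
      by_cases hj : j = i
      · subst hj; simp; exact ((contDiff_infty_iff_deriv.1 (hf _)).2)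
      · rw [Function.update_of_ne hj]; exact hf j

theorem contDiff_deriv_iter (k : ℕ) : ∀ (f : ℝ → ℝ) (_ : ContDiff ℝ ∞ f), ContDiff ℝ ∞ (deriv^[k] f) := by
  induction k with
  | zero => intro f hf; exact hf
  | succ k ih => intro f hf; exact ih _ (contDiff_infty_iff_deriv.1 hf).2

theorem partialD_prod {n : ℕ} (α : Fin n → ℕ) (f : Fin n → ℝ → ℝ) (hf : ∀ j, ContDiff ℝ ∞ (f j)) :
    partialD n α (fun y => ∏ j, f j (y j)) = fun y => ∏ j, (deriv^[α j] (f j)) (y j) := by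
  have key : ∀ l : List (Fin n), l.Nodup →
     l.foldr (fun i g => (pderivE n i)^[α i] g) (fun y => ∏ j, f j (y j)) =
      fun y => ∏ j, (if j ∈ l then deriv^[α j] (f j) else f j) (y j) := by
    intro l hl
    induction l with
    | nil => simp
    | cons i l ih =>
      rw [List.nodup_cons] at hl
      simp only [List.foldr_cons]
      rw [ih hl.2, pd_iter_prod]
      · funext y
        apply Finset.prod_congr rfl
        intro j _
        by_cases hj : j = i
        · subst hj; simp [hl.1]
        · rw [Function.update_of_ne hj]; simp [hj]
      · intro j
        split_ifs
        · exact contDiff_deriv_iter _ _ (hf j)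
        · exact hf j
  unfold partialD
  rw [key _ (List.nodup_finRange n)]
  simp

/-- Normalized centered monomial. -/
noncomputable def ptMono {n : ℕ} (α : Fin n → ℕ) (x y : EuclideanSpace ℝ (Fin n)) : ℝ :=
  ∏ j, (y j - x j) ^ (α j) / ((α j).factorial : ℝ)

theorem ptMono_contDiff {n : ℕ} (α : Fin n → ℕ) (x : EuclideanSpace ℝ (Fin n)) (N : WithTop ℕ∞) :
    ContDiff ℝ N (ptMono α x) := by
  unfold ptMono
  fun_prop

theorem pt_deriv_pow (c : ℝ) (k : ℕ) : ∀ a : ℕ,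
    deriv^[k] (fun t : ℝ => (t - c) ^ a / (a.factorial : ℝ)) c = if k = a then 1 else 0 := by
  induction k with
  | zero => intro a; rcases a with _ | a <;> simp
  | succ k ih =>
    intro a
    rw [Function.iterate_succ_apply]
    rcases a with _ | a
    · have : deriv (fun t : ℝ => (t - c) ^ 0 / ((0:ℕ).factorial : ℝ)) = fun _ => 0 := by
        funext t; simp
      rw [this]
      have : ∀ j : ℕ, deriv^[j] (fun _ : ℝ => (0:ℝ)) = fun _ => 0 := by
        intro j
        induction j with
        | zero => rfl
        | succ j ih => rw [Function.iterate_succ_apply', ih]; funext t; simp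
      rw [this]; simp
    · have : deriv (fun t : ℝ => (t - c) ^ (a + 1) / ((a + 1).factorial : ℝ)) =
          fun t => (t - c) ^ a / (a.factorial : ℝ) := by
        funext t
        have h := ((((hasDerivAt_id t).sub_const c).pow (a + 1)).div_const ((a + 1).factorial : ℝ))
        refine h.deriv.trans ?_
        have : (a.factorial : ℝ) ≠ 0 := by positivity
        simp [Nat.factorial_succ]
        field_simp
      rw [this, ih a]
      simp

theorem partialD_ptMono {n : ℕ} (α β : Fin n → ℕ) (x : EuclideanSpace ℝ (Fin n)) :
    partialD n β (ptMono α x) x = if α = β then 1 else 0 := by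
  have := partialD_prod β (fun j t => (t - x j) ^ (α j) / ((α j).factorial : ℝ))
    (fun j => by fun_prop)
  unfold ptMono
  rw [this]
  simp only [pt_deriv_pow]
  split_ifs with h
  · subst h; simp
  · obtain ⟨j, hj⟩ := Function.ne_iff.1 h
    exact Finset.prod_eq_zero (Finset.mem_univ j) (if_neg (Ne.symm hj))

theorem ptMono_expand {n : ℕ} (α : Fin n → ℕ) (x : EuclideanSpace ℝ (Fin n)) :
    ptMono α x = ∑ β ∈ Fintype.piFinset (fun j => Finset.range (α j + 1)),
      (∏ j, (- x j) ^ (α j - β j) / ((α j - β j).factorial : ℝ)) • ptMono β 0 := by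
  funext y
  unfold ptMono
  have h : ∀ j, (y j - x j) ^ (α j) / ((α j).factorial : ℝ) = ∑ k ∈ Finset.range (α j + 1),
      (- x j) ^ (α j - k) / ((α j - k).factorial : ℝ) * (y j ^ k / (k.factorial : ℝ)) := by
    intro j
    rw [sub_eq_add_neg, add_pow, Finset.sum_div]
    apply Finset.sum_congr rfl
    intro k hk
    have hk : k ≤ α j := by simp at hk; omega
    rw [Nat.cast_choose ℝ hk]
    have h1 : ((α j).factorial : ℝ) ≠ 0 := by positivity
    field_simp
  simp only [h]
  rw [Finset.prod_univ_sum]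
  simp [Finset.prod_mul_distrib]

theorem pd_wave {n : ℕ} (ξ x : EuclideanSpace ℝ (Fin n)) (i : Fin n) (c : ℝ) (h h' : ℝ → ℝ)
    (hh : ∀ t, HasDerivAt h (h' t) t) :
    pderivE n i (fun y => c * h (inner ℝ ξ (y - x))) =
      fun y => (ξ i * c) * h' (inner ℝ ξ (y - x)) := by
  funext y
  have h1 : HasFDerivAt (fun y : EuclideanSpace ℝ (Fin n) => inner ℝ ξ (y - x)) (innerSL ℝ ξ) y := by
    have := ((innerSL ℝ ξ).hasFDerivAt (x := y - x)).comp y ((hasFDerivAt_id y).sub_const x)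
    rw [ContinuousLinearMap.comp_id] at this
    exact this
  have h2 := ((hh (inner ℝ ξ (y - x))).comp_hasFDerivAt y h1).const_mul c
  simp only [pderivE]
  have h3 := h2.fderiv
  simp only [Function.comp_def] at h3
  rw [h3]
  simp [EuclideanSpace.inner_single_right]
  ring

theorem pd_iter_wave {n : ℕ} (ξ x : EuclideanSpace ℝ (Fin n)) (i : Fin n) (m : ℕ) (G : ℕ → ℝ → ℝ)
    (hG : ∀ j < m, ∀ t, HasDerivAt (G j) (G (j + 1) t) t) (k : ℕ) : ∀ (c : ℝ) (j : ℕ) (_ : j + k ≤ m),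
    (pderivE n i)^[k] (fun y => c * G j (inner ℝ ξ (y - x))) =
      fun y => (ξ i ^ k * c) * G (j + k) (inner ℝ ξ (y - x)) := by
  induction k with
  | zero => intro c j _; simp
  | succ k ih =>
    intro c j hj
    rw [Function.iterate_succ_apply, pd_wave ξ x i c _ _ (hG j (by omega)), ih _ (j + 1) (by omega)]
    funext y
    rw [show j + 1 + k = j + (k + 1) by omega]; ring

theorem partialD_wave {n : ℕ} (ξ x : EuclideanSpace ℝ (Fin n)) (m : ℕ) (G : ℕ → ℝ → ℝ)
    (hG : ∀ j < m, ∀ t, HasDerivAt (G j) (G (j + 1) t) t) (α : Fin n → ℕ) (hα : ∑ i, α i ≤ m) :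
    partialD n α (fun y => G 0 (inner ℝ ξ (y - x))) =
      fun y => (∏ i, ξ i ^ α i) * G (∑ i, α i) (inner ℝ ξ (y - x)) := by
  have key : ∀ l : List (Fin n), (l.map α).sum ≤ m →
      l.foldr (fun i g => (pderivE n i)^[α i] g) (fun y => G 0 (inner ℝ ξ (y - x))) =
      fun y => ((l.map fun i => ξ i ^ α i).prod) * G (l.map α).sum (inner ℝ ξ (y - x)) := by
    intro l hl
    induction l with
    | nil => simp
    | cons i l ih =>
      simp only [List.map_cons, List.sum_cons, List.foldr_cons, List.prod_cons] at hl ⊢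
      rw [ih (by omega), pd_iter_wave ξ x i m G hG _ _ _ (by omega), add_comm (α i)]
  unfold partialD
  rw [key _ (by rwa [pd_sum_finRange]), pd_sum_finRange]
  simp [Fin.prod_univ_def]

theorem hasDerivAt_mul_abs' (t : ℝ) : HasDerivAt (fun t : ℝ => t * |t|) (2 * |t|) t := by
  by_cases ht : t = 0
  · subst ht
    rw [hasDerivAt_iff_tendsto_slope_zero]
    simp only [zero_add, abs_zero, mul_zero, sub_zero, smul_eq_mul]
    have : Tendsto (fun t : ℝ => |t|) (𝓝[≠] 0) (𝓝 0) := by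
      have := (continuous_abs (G := ℝ)).tendsto 0
      simp only [abs_zero] at this
      exact this.mono_left nhdsWithin_le_nhds
    refine this.congr' ?_
    filter_upwards [self_mem_nhdsWithin] with t ht
    rw [inv_mul_cancel_left₀ ht]
  · have h := (hasDerivAt_id t).mul (hasDerivAt_abs ht)
    refine h.congr_deriv ?_
    rw [id, mul_comm t, sign_mul_self]; ring

/-- The function `t ^ N * |t|`. -/
noncomputable def ptH (N : ℕ) (t : ℝ) : ℝ := t ^ N * |t|

theorem hasDerivAt_ptH (N : ℕ) (t : ℝ) : HasDerivAt (ptH (N + 1)) ((N + 2) * ptH N t) t := by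
  have h := (hasDerivAt_pow N t).mul (hasDerivAt_mul_abs' t)
  have e : ptH (N + 1) = (fun t : ℝ => t ^ N) * (fun t => t * |t|) := by
    funext t; simp only [ptH, Pi.mul_apply]; ring
  rw [e]
  refine h.congr_deriv ?_
  rcases N with _ | N
  · simp [ptH]
  · simp [ptH]; ring

theorem contDiff_ptH (N : ℕ) : ContDiff ℝ (N : ℕ) (ptH N) := by
  induction N with
  | zero =>
    rw [Nat.cast_zero, contDiff_zero]
    unfold ptH
    fun_prop
  | succ N ih =>
    push_cast
    rw [contDiff_succ_iff_deriv]
    refine ⟨fun t => (hasDerivAt_ptH N t).differentiableAt, by simp, ?_⟩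
    have : deriv (ptH (N + 1)) = fun t => ((N : ℝ) + 2) * ptH N t := by
      funext t; exact (hasDerivAt_ptH N t).deriv
    rw [this]
    exact contDiff_const.mul ih

theorem not_contDiffAt_ptH (N : ℕ) : ¬ ContDiffAt ℝ (N + 1 : ℕ) (ptH N) 0 := by
  induction N with
  | zero =>
    intro h
    have h := h.differentiableAt (by simp)
    have e : ptH 0 = fun t : ℝ => |t| := by funext t; simp [ptH]
    rw [e] at h
    exact not_differentiableAt_abs_zero h
  | succ N ih =>
    intro h
    apply ih
    have h1 : ContDiffAt ℝ (N + 1 : ℕ) (fun t => fderiv ℝ (ptH (N + 1)) t 1) 0 :=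
      (h.fderiv_right (m := (N + 1 : ℕ)) (by push_cast; exact le_rfl)).clm_apply contDiffAt_const
    have : (fun t => fderiv ℝ (ptH (N + 1)) t 1) = fun t => ((N : ℝ) + 2) * ptH N t := by
      funext t; rw [fderiv_apply_one_eq_deriv]; exact (hasDerivAt_ptH N t).deriv
    rw [this] at h1
    have h2 := (contDiffAt_const (c := ((N : ℝ) + 2)⁻¹)).mul h1
    refine h2.congr_of_eventuallyEq (Eventually.of_forall fun t => ?_)
    have : (N : ℝ) + 2 ≠ 0 := by positivity
    field_simp

theorem mem_multiIdx' {n k : ℕ} {α : Fin n → ℕ} : α ∈ multiIdx n k ↔ ∑ i, α i ≤ k := by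
  unfold multiIdx
  simp only [Finset.mem_filter, Finset.mem_Iic, and_iff_right_iff_imp]
  intro h j
  exact (Finset.single_le_sum (f := α) (fun i _ => Nat.zero_le _) (Finset.mem_univ j)).trans h

theorem exists_poly_ne {n : ℕ} (S : Finset (Fin n → ℕ)) (c : (Fin n → ℕ) → ℝ) (α : Fin n → ℕ)
    (hα : α ∈ S) (hc : c α ≠ 0) : ∃ ξ : Fin n → ℝ, ∑ β ∈ S, c β * ∏ i, ξ i ^ β i ≠ 0 := by
  classical
  by_contra! h
  let p : MvPolynomial (Fin n) ℝ :=
    ∑ β ∈ S, MvPolynomial.monomial (Finsupp.equivFunOnFinite.symm β) (c β)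
  have hp : p = 0 := by
    apply MvPolynomial.funext
    intro ξ
    simp only [p, map_sum, MvPolynomial.eval_monomial, map_zero]
    rw [← h ξ]
    apply Finset.sum_congr rfl
    intro β _
    rw [Finsupp.prod_fintype _ _ (by simp)]
    simp
  have h1 := congrArg (MvPolynomial.coeff (Finsupp.equivFunOnFinite.symm α)) hp
  simp only [p, MvPolynomial.coeff_sum, MvPolynomial.coeff_monomial, MvPolynomial.coeff_zero,
    EmbeddingLike.apply_eq_iff_eq] at h1
  rw [Finset.sum_ite_eq' S α c] at h1
  simp [hα, hc] at h1

theorem exists_global {n m : ℕ} (V : Set (EuclideanSpace ℝ (Fin n))) (hV : IsOpen V)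
    (φ : EuclideanSpace ℝ (Fin n) → ℝ) (hφ : ContDiffOn ℝ (m : ℕ) φ V)
    (x : EuclideanSpace ℝ (Fin n)) (hx : x ∈ V) :
    ∃ ψ, ContDiff ℝ (m : ℕ) ψ ∧ ∃ W, IsOpen W ∧ x ∈ W ∧ W ⊆ V ∧ ∀ y ∈ W, φ y = ψ y := by
  obtain ⟨ε, hε, hb⟩ := Metric.isOpen_iff.1 hV x hx
  let b : ContDiffBump x := ⟨ε / 4, ε / 2, by linarith, by linarith⟩
  refine ⟨fun y => b y * φ y, ?_, Metric.ball x (ε / 4), Metric.isOpen_ball, by simp [hε], ?_, ?_⟩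
  · rw [contDiff_iff_contDiffAt]
    intro y
    by_cases hy : y ∈ V
    · exact (b.contDiffAt).mul ((hφ y hy).contDiffAt (hV.mem_nhds hy))
    · have : (fun y => b y * φ y) =ᶠ[𝓝 y] fun _ => 0 := by
        have hy' : y ∈ (Metric.closedBall x (ε / 2))ᶜ := by
          intro h; exact hy (hb (Metric.closedBall_subset_ball (by linarith) h))
        filter_upwards [Metric.isClosed_closedBall.isOpen_compl.mem_nhds hy'] with z hz
        rw [b.zero_of_le_dist, zero_mul]
        simp only [Set.mem_compl_iff, Metric.mem_closedBall, not_le] at hz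
        exact hz.le
      exact contDiffAt_const.congr_of_eventuallyEq this
  · exact (Metric.ball_subset_ball (by linarith)).trans hb
  · intro y hy
    change φ y = b y * φ y
    rw [b.one_of_mem_closedBall, one_mul]
    exact Metric.ball_subset_closedBall hy

section
variable {n m r : ℕ} {U : Set (EuclideanSpace ℝ (Fin n))}

theorem sh_congr (u : SheafHom n m r U) (hU : IsOpen U) {f g : EuclideanSpace ℝ (Fin n) → ℝ}
    (hf : ContDiff ℝ (m : ℕ) f) (hg : ContDiff ℝ (m : ℕ) g)
    (W : Set (EuclideanSpace ℝ (Fin n))) (hW : IsOpen W) (h : ∀ y ∈ W, f y = g y)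
    (x : EuclideanSpace ℝ (Fin n)) (hx : x ∈ W) (hxU : x ∈ U) : u.app U f x = u.app U g x := by
  have h1 := u.restrict U subset_rfl hU (U ∩ W) Set.inter_subset_left (hU.inter hW) f g
    hf.contDiffOn hg.contDiffOn (fun y hy => h y hy.2) x ⟨hxU, hx⟩
  have h2 := u.restrict U subset_rfl hU (U ∩ W) Set.inter_subset_left (hU.inter hW) g g
    hg.contDiffOn hg.contDiffOn (fun y hy => rfl) x ⟨hxU, hx⟩
  rw [h1, h2]

theorem sh_zero (u : SheafHom n m r U) (hU : IsOpen U)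
    (x : EuclideanSpace ℝ (Fin n)) (hxU : x ∈ U) : u.app U 0 x = 0 := by
  have := u.map_smul U subset_rfl hU 0 0 contDiffOn_const x hxU
  simpa using this

theorem sh_sum (u : SheafHom n m r U) (hU : IsOpen U) {ι : Type} (s : Finset ι) (c : ι → ℝ)
    (f : ι → EuclideanSpace ℝ (Fin n) → ℝ) (hf : ∀ j, ContDiff ℝ (m : ℕ) (f j))
    (x : EuclideanSpace ℝ (Fin n)) (hxU : x ∈ U) :
    u.app U (∑ j ∈ s, c j • f j) x = ∑ j ∈ s, c j * u.app U (f j) x := by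
  classical
  induction s using Finset.induction_on with
  | empty => simpa using sh_zero u hU x hxU
  | insert j s hj ih =>
    rw [Finset.sum_insert hj, Finset.sum_insert hj, ← ih]
    have hs : ContDiff ℝ (m : ℕ) (∑ j ∈ s, c j • f j) := by
      have : (∑ j ∈ s, c j • f j) = fun y => ∑ j ∈ s, (c j • f j) y := by
        funext y; simp
      rw [this]
      exact ContDiff.sum fun j _ => (hf j).const_smul (c j)
    rw [u.map_add U subset_rfl hU (c j • f j) _ ((hf j).const_smul (c j)).contDiffOn hs.contDiffOn x hxU,
      u.map_smul U subset_rfl hU _ _ (hf j).contDiffOn x hxU]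

theorem sh_flat (u : SheafHom n m r U) (hn : 1 ≤ n) (hU : IsOpen U)
    {f : EuclideanSpace ℝ (Fin n) → ℝ} (hf : ContDiff ℝ (m : ℕ) f)
    (x : EuclideanSpace ℝ (Fin n)) (hxU : x ∈ U)
    (h0 : ∀ k ≤ m, iteratedFDeriv ℝ k f x = 0) : u.app U f x = 0 := by
  set e : EuclideanSpace ℝ (Fin n) := EuclideanSpace.single ⟨0, hn⟩ 1 with he
  have hee : inner ℝ e e = (1 : ℝ) := by
    rw [real_inner_self_eq_norm_sq]; simp [he]
  have hne : ‖e‖ = 1 := by simp [he]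
  obtain ⟨ψ, hψ, h1, h2⟩ := pt_cone m e (fun y => f (x + y)) (hf.comp (contDiff_const.add contDiff_id))
    (fun k hk => by rw [iteratedFDeriv_comp_add_left, add_zero]; exact h0 k hk)
  set g : EuclideanSpace ℝ (Fin n) → ℝ := fun y => ψ (y - x) with hg
  have hgc : ContDiff ℝ (m : ℕ) g := hψ.comp (contDiff_id.sub contDiff_const)
  have cont : ∀ φ, ContDiff ℝ (m : ℕ) φ → ContinuousAt (u.app U φ) x := fun φ hφ =>
    (u.map_contDiffOn U subset_rfl hU φ hφ.contDiffOn).continuousOn.continuousAt (hU.mem_nhds hxU)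
  have line : Tendsto (fun t : ℝ => x + t • e) (𝓝 0) (𝓝 x) := by
    have : Continuous (fun t : ℝ => x + t • e) := by fun_prop
    simpa using this.tendsto 0
  have lineU : ∀ᶠ t : ℝ in 𝓝 0, x + t • e ∈ U := line.eventually (hU.mem_nhds hxU)
  have W1 : IsOpen {y : EuclideanSpace ℝ (Fin n) | ‖y - x‖ < 2 * inner ℝ e (y - x)} :=
    isOpen_lt (by fun_prop) (by fun_prop)
  have W2 : IsOpen {y : EuclideanSpace ℝ (Fin n) | inner ℝ e (y - x) < (0 : ℝ)} :=
    isOpen_lt (by fun_prop) (by fun_prop)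
  have e1 : u.app U f x = u.app U g x := by
    refine tendsto_nhds_unique (f := fun t : ℝ => u.app U f (x + t • e)) (l := 𝓝[>] (0:ℝ))
      (((cont f hf).tendsto.comp line).mono_left nhdsWithin_le_nhds) ?_
    refine (((cont g hgc).tendsto.comp line).mono_left nhdsWithin_le_nhds).congr' ?_
    filter_upwards [self_mem_nhdsWithin, nhdsWithin_le_nhds lineU] with t ht htU
    have ht : 0 < t := ht
    refine sh_congr u hU hgc hf _ W1 (fun y hy => ?_) _ ?_ htU
    · simp only [hg]; rw [h1 _ hy]; simp
    · simp only [Set.mem_ofPred_eq, add_sub_cancel_left, inner_smul_right, hee, norm_smul, hne,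
        Real.norm_eq_abs, abs_of_pos ht]
      linarith
  have e2 : u.app U g x = 0 := by
    refine tendsto_nhds_unique (f := fun t : ℝ => u.app U g (x + t • e)) (l := 𝓝[<] (0:ℝ))
      (((cont g hgc).tendsto.comp line).mono_left nhdsWithin_le_nhds) ?_
    refine tendsto_const_nhds.congr' ?_
    filter_upwards [self_mem_nhdsWithin, nhdsWithin_le_nhds lineU] with t ht htU
    have ht : t < 0 := ht
    rw [← sh_zero u hU _ htU]
    refine sh_congr u hU contDiff_const hgc _ W2 (fun y hy => ?_) _ ?_ htU
    · simp only [hg]; rw [h2 _ hy]; rfl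
    · simpa only [Set.mem_ofPred_eq, add_sub_cancel_left, inner_smul_right, hee, mul_one] using ht
  rw [e1, e2]

/-- The coefficients. -/
noncomputable def shCoeff (u : SheafHom n m r U) (α : Fin n → ℕ) (x : EuclideanSpace ℝ (Fin n)) : ℝ :=
  u.app U (ptMono α x) x

theorem sh_formula (u : SheafHom n m r U) (hn : 1 ≤ n) (hU : IsOpen U)
    {f : EuclideanSpace ℝ (Fin n) → ℝ} (hf : ContDiff ℝ (m : ℕ) f)
    (x : EuclideanSpace ℝ (Fin n)) (hxU : x ∈ U) :
    u.app U f x = ∑ α ∈ multiIdx n m, shCoeff u α x * partialD n α f x := by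
  set T : EuclideanSpace ℝ (Fin n) → ℝ :=
    ∑ α ∈ multiIdx n m, (partialD n α f x) • ptMono α x with hT
  have hTc : ∀ N : WithTop ℕ∞, ContDiff ℝ N T := by
    intro N
    have : T = fun y => ∑ α ∈ multiIdx n m, ((partialD n α f x) • ptMono α x) y := by
      funext y; simp [hT]
    rw [this]
    exact ContDiff.sum fun α _ => (ptMono_contDiff α x N).const_smul (partialD n α f x)
  have hTd : ∀ β ∈ multiIdx n m, partialD n β T x = partialD n β f x := by
    intro β hβ
    rw [hT, partialD_sum β _ _ _ (fun j => ptMono_contDiff j x _)]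
    simp only [Finset.sum_apply, Pi.smul_apply, partialD_ptMono, smul_eq_mul, mul_ite, mul_one,
      mul_zero]
    rw [Finset.sum_ite_eq' _ β]
    simp [hβ]
  have hR : ContDiff ℝ (m : ℕ) (f - T) := hf.sub (hTc _)
  have h1 : u.app U (f - T) x = 0 := by
    apply sh_flat u hn hU hR x hxU
    intro k hk
    apply flat_of_partialD x k _ (hR.of_le (by exact_mod_cast hk))
    intro α hα
    have := partialD_lin α 1 (-1) (f := f) (g := T) (hf.of_le (by rw [hα]; exact_mod_cast hk)) (hTc _)
    simp only [one_smul, neg_smul, ← sub_eq_add_neg] at this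
    rw [this, Pi.sub_apply, hTd α (mem_multiIdx'.2 (by omega)), sub_self]
  have h2 := u.map_add U subset_rfl hU (f - T) T hR.contDiffOn (hTc _).contDiffOn x hxU
  rw [sub_add_cancel, h1, zero_add, hT, sh_sum u hU _ _ _ (fun j => ptMono_contDiff j x _) x hxU] at h2
  rw [h2]
  exact Finset.sum_congr rfl fun α _ => mul_comm _ _

theorem shCoeff_contDiffOn (u : SheafHom n m r U) (hU : IsOpen U) (α : Fin n → ℕ) :
    ContDiffOn ℝ (r : ℕ) (shCoeff u α) U := by
  have : ContDiffOn ℝ (r : ℕ) (fun x => ∑ β ∈ Fintype.piFinset (fun j => Finset.range (α j + 1)),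
      (∏ j, (- x j) ^ (α j - β j) / ((α j - β j).factorial : ℝ)) * u.app U (ptMono β 0) x) U := by
    apply ContDiffOn.sum
    intro β _
    refine ContDiffOn.mul (ContDiff.contDiffOn (by fun_prop)) ?_
    exact u.map_contDiffOn U subset_rfl hU _ (ptMono_contDiff β 0 _).contDiffOn
  refine this.congr fun x hx => ?_
  unfold shCoeff
  conv_lhs => rw [ptMono_expand]
  exact sh_sum u hU _ _ _ (fun β => ptMono_contDiff β 0 _) x hx

theorem shCoeff_vanish (u : SheafHom n m r U) (hn : 1 ≤ n) (hrm : r ≤ m) (hU : IsOpen U) (d : ℕ) :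
    ∀ (α : Fin n → ℕ) (_ : m - ∑ i, α i = d) (_ : ∑ i, α i ≤ m) (_ : m - r < ∑ i, α i),
      ∀ x ∈ U, shCoeff u α x = 0 := by
  induction d using Nat.strong_induction_on with
  | _ d ih =>
  intro α hd hαm hαr x₀ hx₀
  by_contra hne
  set k := ∑ i, α i with hk
  obtain ⟨ξ', hξ'⟩ := exists_poly_ne ((multiIdx n m).filter fun β => ∑ i, β i = k)
    (fun β => shCoeff u β x₀) α (by simp [mem_multiIdx', hαm, ← hk]) hne
  set ξ : EuclideanSpace ℝ (Fin n) := WithLp.toLp 2 ξ' with hξ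
  have hξi : ∀ i, ξ i = ξ' i := fun i => rfl
  have hξ0 : ξ ≠ 0 := by
    intro h
    apply hξ'
    apply Finset.sum_eq_zero
    intro β hβ
    simp only [Finset.mem_filter] at hβ
    obtain ⟨i, hi⟩ : ∃ i, β i ≠ 0 := by
      by_contra! hcon
      have : ∑ i, β i = 0 := by simp [hcon]
      omega
    rw [Finset.prod_eq_zero (Finset.mem_univ i), mul_zero]
    rw [← hξi, h]; simp [hi]
  let G : ℕ → ℝ → ℝ := fun j t => ((m + 1).descFactorial j : ℝ) * ptH (m - j) t
  have hG : ∀ j < m, ∀ t, HasDerivAt (G j) (G (j + 1) t) t := by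
    intro j hj t
    obtain ⟨N, rfl⟩ : ∃ N, m = j + 1 + N := ⟨m - j - 1, by omega⟩
    have h := (hasDerivAt_ptH N t).const_mul (((j + 1 + N + 1).descFactorial j : ℝ))
    simp only [G]
    rw [show j + 1 + N - j = N + 1 by omega, show j + 1 + N - (j + 1) = N by omega,
      Nat.descFactorial_succ, show j + 1 + N + 1 - j = N + 2 by omega]
    refine h.congr_deriv ?_
    push_cast; ring
  have hGc : ∀ j, ContDiff ℝ (m - j : ℕ) (G j) := fun j => contDiff_const.mul (contDiff_ptH _)
  have hℓ : ∀ N : WithTop ℕ∞, ContDiff ℝ N (fun y : EuclideanSpace ℝ (Fin n) => inner ℝ ξ (y - x₀)) :=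
    fun N => contDiff_const.inner ℝ (contDiff_id.sub contDiff_const)
  set φ : EuclideanSpace ℝ (Fin n) → ℝ := fun y => G 0 (inner ℝ ξ (y - x₀)) with hφ
  have hφc : ContDiff ℝ (m : ℕ) φ := (hGc 0).comp (hℓ _)
  set P : EuclideanSpace ℝ (Fin n) → ℝ := fun y =>
    ∑ β ∈ (multiIdx n m).filter (fun β => ∑ i, β i = k), shCoeff u β y * ∏ i, ξ' i ^ β i with hP
  set Q : EuclideanSpace ℝ (Fin n) → ℝ := fun y =>
    ∑ β ∈ (multiIdx n m).filter (fun β => ∑ i, β i < k),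
      shCoeff u β y * ((∏ i, ξ' i ^ β i) * G (∑ i, β i) (inner ℝ ξ (y - x₀))) with hQ
  have hform : ∀ y ∈ U, u.app U φ y = P y * G k (inner ℝ ξ (y - x₀)) + Q y := by
    intro y hy
    rw [sh_formula u hn hU hφc y hy]
    simp only [hP, hQ, Finset.sum_mul, Finset.sum_filter]
    rw [← Finset.sum_add_distrib]
    apply Finset.sum_congr rfl
    intro β hβ
    have hβm := mem_multiIdx'.1 hβ
    rw [hφ, partialD_wave ξ x₀ m G hG β hβm]
    simp only [hξi]
    rcases lt_trichotomy (∑ i, β i) k with h | h | h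
    · simp [h, h.ne]
    · simp [h]; ring
    · rw [ih (m - ∑ i, β i) (by omega) β rfl hβm (by omega) y hy]
      simp [h.ne', h.not_gt]
  have hs : m - k + 1 ≤ r := by omega
  have hcoef : ∀ β, ContDiffAt ℝ (m - k + 1 : ℕ) (shCoeff u β) x₀ := fun β =>
    (((shCoeff_contDiffOn u hU β) x₀ hx₀).contDiffAt (hU.mem_nhds hx₀)).of_le (by exact_mod_cast hs)
  have hPc : ContDiffAt ℝ (m - k + 1 : ℕ) P x₀ :=
    ContDiffAt.sum fun β _ => (hcoef β).mul contDiffAt_const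
  have hQc : ContDiffAt ℝ (m - k + 1 : ℕ) Q x₀ := by
    apply ContDiffAt.sum
    intro β hβ
    simp only [Finset.mem_filter] at hβ
    refine (hcoef β).mul (contDiffAt_const.mul ?_)
    exact (((hGc (∑ i, β i)).of_le (by exact_mod_cast (by omega))).comp (hℓ _)).contDiffAt
  have huc' : ContDiffAt ℝ (r : ℕ) (u.app U φ) x₀ :=
    ((u.map_contDiffOn U subset_rfl hU φ hφc.contDiffOn) x₀ hx₀).contDiffAt (hU.mem_nhds hx₀)
  have huc : ContDiffAt ℝ (m - k + 1 : ℕ) (u.app U φ) x₀ :=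
    huc'.of_le (by exact_mod_cast hs)
  have hGk : ContDiffAt ℝ (m - k + 1 : ℕ) (fun y => G k (inner ℝ ξ (y - x₀))) x₀ := by
    refine ((huc.sub hQc).div hPc hξ').congr_of_eventuallyEq ?_
    filter_upwards [hU.mem_nhds hx₀, hPc.continuousAt.eventually_ne hξ'] with y hy hPy
    simp only [Pi.div_apply]
    rw [hform y hy, add_sub_cancel_right, mul_div_cancel_left₀ _ hPy]
  have hξξ : inner ℝ ξ ξ ≠ (0:ℝ) := by simpa using hξ0
  have hcomp : ContDiffAt ℝ (m - k + 1 : ℕ) (fun t : ℝ => G k t) 0 := by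
    have hline : ContDiffAt ℝ (m - k + 1 : ℕ) (fun t : ℝ => x₀ + t • ((inner ℝ ξ ξ : ℝ)⁻¹ • ξ)) 0 := by
      fun_prop
    have h := ContDiffAt.comp (x := (0:ℝ)) (f := fun t : ℝ => x₀ + t • ((inner ℝ ξ ξ : ℝ)⁻¹ • ξ))
      (g := fun y => G k (inner ℝ ξ (y - x₀))) (by simpa using hGk) hline
    refine h.congr_of_eventuallyEq (Eventually.of_forall fun t => ?_)
    simp only [Function.comp, add_sub_cancel_left, inner_smul_right]
    rw [inv_mul_cancel₀ hξξ, mul_one]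
  apply not_contDiffAt_ptH (m - k)
  have hc : ((m + 1).descFactorial k : ℝ) ≠ 0 := by
    rw [Nat.cast_ne_zero, Ne, Nat.descFactorial_eq_zero_iff_lt]; omega
  refine ((contDiffAt_const (c := ((m + 1).descFactorial k : ℝ)⁻¹)).mul hcomp).congr_of_eventuallyEq
    (Eventually.of_forall fun t => ?_)
  simp only [G]
  rw [inv_mul_cancel_left₀ hc]

end

/-- Every morphism of sheaves `u : C^m → C^r` over a nonempty open `U ⊆ ℝⁿ` (with `r ≤ m`)
is given by a unique differential operator of order `≤ m - r` with `C^r` coefficients. -/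
theorem stmt_0 (n m r : ℕ) (hn : 1 ≤ n) (hrm : r ≤ m)
    (U : Set (EuclideanSpace ℝ (Fin n))) (hU : IsOpen U) (hUne : U.Nonempty)
    (u : SheafHom n m r U) :
    ∃ a : (Fin n → ℕ) → EuclideanSpace ℝ (Fin n) → ℝ,
      ((∀ α ∈ multiIdx n (m - r), ContDiffOn ℝ (r : ℕ∞) (a α) U) ∧
        ∀ V, V ⊆ U → IsOpen V → ∀ φ, ContDiffOn ℝ (m : ℕ∞) φ V → ∀ x ∈ V,
          u.app V φ x = ∑ α ∈ multiIdx n (m - r), a α x * partialD n α φ x) ∧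
      ∀ b : (Fin n → ℕ) → EuclideanSpace ℝ (Fin n) → ℝ,
        ((∀ α ∈ multiIdx n (m - r), ContDiffOn ℝ (r : ℕ∞) (b α) U) ∧
          ∀ V, V ⊆ U → IsOpen V → ∀ φ, ContDiffOn ℝ (m : ℕ∞) φ V → ∀ x ∈ V,
            u.app V φ x = ∑ α ∈ multiIdx n (m - r), b α x * partialD n α φ x) →
        ∀ α ∈ multiIdx n (m - r), ∀ x ∈ U, b α x = a α x := by
  refine ⟨shCoeff u, ⟨fun α _ => shCoeff_contDiffOn u hU α, ?_⟩, ?_⟩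
  · intro V hVU hV φ hφ x hx
    obtain ⟨ψ, hψ, W, hW, hxW, hWV, heq⟩ := exists_global V hV φ hφ x hx
    have h1 := u.restrict V hVU hV W hWV hW φ ψ hφ hψ.contDiffOn heq x hxW
    have h2 := u.restrict U subset_rfl hU W (hWV.trans hVU) hW ψ ψ hψ.contDiffOn hψ.contDiffOn
      (fun _ _ => rfl) x hxW
    rw [h1, ← h2, sh_formula u hn hU hψ x (hVU hx)]
    have hsub : multiIdx n (m - r) ⊆ multiIdx n m := by
      intro α hα
      rw [mem_multiIdx'] at hα ⊢
      omega
    rw [← Finset.sum_subset hsub]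
    · apply Finset.sum_congr rfl
      intro α _
      have : φ =ᶠ[𝓝 x] ψ := by
        filter_upwards [hW.mem_nhds hxW] with y hy using heq y hy
      rw [(partialD_congr α this).eq_of_nhds]
    · intro α hα hα'
      rw [mem_multiIdx'] at hα hα'
      rw [shCoeff_vanish u hn hrm hU _ α rfl hα (by omega) x (hVU hx), zero_mul]
  · rintro b ⟨_, hb⟩ α hα x hx
    unfold shCoeff
    rw [hb U subset_rfl hU (ptMono α x) (ptMono_contDiff α x _).contDiffOn x hx]
    simp only [partialD_ptMono, mul_ite, mul_one, mul_zero]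
    rw [Finset.sum_ite_eq]
    simp [hα]
end

section
/- Let n ≥ 1, let m be a natural number, and let U be an open subset of ℝⁿ. Then every morphism of sheaves u : C^m → C^{m+1} over U is zero: for every open V ⊆ U, every φ ∈ C^m(V) and every x ∈ V, u_V(φ)(x) = 0. -/
open scoped BigOperators

/-- Formal expansion of `u ((ℓ - s)^i ℓ^j φ)` in terms of `w j = u (ℓ^j φ)`. -/
def expd {α : Type} (w : ℕ → α → ℝ) : ℕ → ℕ → ℝ → α → ℝ
  | 0, j, _, t => w j t
  | (i + 1), j, s, t => expd w i (j + 1) s t - s * expd w i j s t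

theorem expd_hasDerivAt (w w' : ℕ → ℝ → ℝ) (t : ℝ)
    (h : ∀ j, HasDerivAt (w j) (w' j t) t) (s : ℝ) (i : ℕ) :
    ∀ j, HasDerivAt (expd w i j s) (expd w' i j s t) t := by
  induction i with
  | zero => intro j; exact h j
  | succ i ih =>
    intro j
    exact (ih (j + 1)).sub ((ih j).const_mul s)

theorem expd_continuousAt (w : ℕ → ℝ → ℝ) (t : ℝ)
    (h : ∀ j, ContinuousAt (w j) t) (s : ℝ) (i : ℕ) :
    ∀ j, ContinuousAt (expd w i j s) t := by
  induction i with
  | zero => intro j; exact h j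
  | succ i ih =>
    intro j
    exact (ih (j + 1)).sub ((ih j).const_mul s)

theorem expd_diag (w w' : ℕ → ℝ → ℝ) (t : ℝ)
    (h : ∀ j, HasDerivAt (w j) (w' j t) t) (i : ℕ) :
    ∀ j, HasDerivAt (fun s => expd w i j s s)
      (expd w' i j t t - i * expd w (i - 1) j t t) t := by
  induction i with
  | zero => intro j; simpa [expd] using h j
  | succ i ih =>
    intro j
    have h1 := (ih (j + 1)).sub ((hasDerivAt_id t).mul (ih j))
    refine h1.congr_deriv ?_
    cases i with
    | zero => simp [expd]; ring
    | succ i => simp [expd]; ring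

theorem iterDeriv_hasDerivAt (N : ℕ) (I : Set ℝ) (hI : IsOpen I) (f : ℝ → ℝ)
    (hf : ContDiffOn ℝ N f I) (k : ℕ) (hk : k < N) (t : ℝ) (ht : t ∈ I) :
    HasDerivAt (iteratedDeriv k f) (iteratedDeriv (k + 1) f t) t := by
  rw [iteratedDeriv_succ]
  apply DifferentiableAt.hasDerivAt
  have h1 := hf.differentiableOn_iteratedDerivWithin (m := k) (by exact_mod_cast hk)
    hI.uniqueDiffOn
  have h2 := (h1 t ht).differentiableAt (hI.mem_nhds ht)
  refine h2.congr_of_eventuallyEq ?_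
  filter_upwards [hI.mem_nhds ht] with y hy
  exact (iteratedDerivWithin_of_isOpen hI hy).symm

theorem iterDeriv_continuousAt (N : ℕ) (I : Set ℝ) (hI : IsOpen I) (f : ℝ → ℝ)
    (hf : ContDiffOn ℝ N f I) (k : ℕ) (hk : k ≤ N) (t : ℝ) (ht : t ∈ I) :
    ContinuousAt (iteratedDeriv k f) t := by
  have h1 := hf.continuousOn_iteratedDerivWithin (m := k) (by exact_mod_cast hk)
    hI.uniqueDiffOn
  have h2 := (h1 t ht).continuousAt (hI.mem_nhds ht)
  refine h2.congr ?_
  filter_upwards [hI.mem_nhds ht] with y hy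
  exact (iteratedDerivWithin_of_isOpen hI hy)

theorem vanish_top (N : ℕ) (I : Set ℝ) (hI : IsOpen I) (w : ℕ → ℝ → ℝ)
    (hw : ∀ j, ContDiffOn ℝ N (w j) I) (s : ℝ) (hs : s ∈ I) (g : ℝ → ℝ)
    (hg : ContDiffOn ℝ N g I) (hp : ∀ t ∈ I, s < t → g t = expd w N 0 s t)
    (hm : ∀ t ∈ I, t < s → g t = 0) (k : ℕ) (hk : k ≤ N) :
    expd (fun j => iteratedDeriv k (w j)) N 0 s s = 0 := by
  have key : ∀ k ≤ N, (∀ t ∈ I, s < t → iteratedDeriv k g t =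
      expd (fun j => iteratedDeriv k (w j)) N 0 s t) ∧
      (∀ t ∈ I, t < s → iteratedDeriv k g t = 0) := by
    intro k
    induction k with
    | zero => intro _; simpa using ⟨hp, hm⟩
    | succ k ih =>
      intro hk
      obtain ⟨h1, h2⟩ := ih (by omega)
      constructor
      · intro t ht hst
        rw [iteratedDeriv_succ]
        have := expd_hasDerivAt (fun j => iteratedDeriv k (w j))
          (fun j => iteratedDeriv (k + 1) (w j)) t
          (fun j => iterDeriv_hasDerivAt N I hI (w j) (hw j) k (by omega) t ht) s N 0
        refine (this.congr_of_eventuallyEq ?_).deriv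
        filter_upwards [hI.mem_nhds ht, lt_mem_nhds hst] with y hy hy'
        exact h1 y hy hy'
      · intro t ht hst
        rw [iteratedDeriv_succ]
        refine ((hasDerivAt_const t (0 : ℝ)).congr_of_eventuallyEq ?_).deriv
        filter_upwards [hI.mem_nhds ht, gt_mem_nhds hst] with y hy hy'
        exact h2 y hy hy'
  obtain ⟨h1, h2⟩ := key k hk
  have cg := iterDeriv_continuousAt N I hI g hg k hk s hs
  have cw := expd_continuousAt (fun j => iteratedDeriv k (w j)) s
    (fun j => iterDeriv_continuousAt N I hI (w j) (hw j) k hk s hs) s N 0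
  have e0 : iteratedDeriv k g s = 0 := by
    refine tendsto_nhds_unique (cg.tendsto.mono_left (nhdsWithin_le_nhds (s := Set.Iio s))) ?_
    refine tendsto_const_nhds.congr' ?_
    filter_upwards [mem_nhdsWithin_of_mem_nhds (hI.mem_nhds hs), self_mem_nhdsWithin] with y hy hy'
    exact (h2 y hy hy').symm
  rw [← e0]
  refine tendsto_nhds_unique (cw.tendsto.mono_left (nhdsWithin_le_nhds (s := Set.Ioi s))) ?_
  refine (cg.tendsto.mono_left (nhdsWithin_le_nhds (s := Set.Ioi s))).congr' ?_
  filter_upwards [mem_nhdsWithin_of_mem_nhds (hI.mem_nhds hs), self_mem_nhdsWithin] with y hy hy'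
  exact (h1 y hy hy')

theorem core_1d (N : ℕ) (I : Set ℝ) (hI : IsOpen I) (w : ℕ → ℝ → ℝ)
    (hw : ∀ j, ContDiffOn ℝ N (w j) I)
    (h : ∀ s ∈ I, ∃ g : ℝ → ℝ, ContDiffOn ℝ N g I ∧
      (∀ t ∈ I, s < t → g t = expd w N 0 s t) ∧ (∀ t ∈ I, t < s → g t = 0)) :
    ∀ s ∈ I, w 0 s = 0 := by
  have main : ∀ d ≤ N, ∀ k ≤ N - d, ∀ s ∈ I,
      expd (fun j => iteratedDeriv k (w j)) (N - d) 0 s s = 0 := by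
    intro d
    induction d with
    | zero =>
      intro _ k hk s hs
      obtain ⟨g, hg, hp, hm⟩ := h s hs
      exact vanish_top N I hI w hw s hs g hg hp hm k hk
    | succ d ih =>
      intro hd k hk s hs
      have ih := ih (by omega)
      have hder := expd_diag (fun j => iteratedDeriv k (w j))
          (fun j => iteratedDeriv (k + 1) (w j)) s
          (fun j => iterDeriv_hasDerivAt N I hI (w j) (hw j) k (by omega) s hs) (N - d) 0
      have hz : HasDerivAt (fun s => expd (fun j => iteratedDeriv k (w j)) (N - d) 0 s s) 0 s := by
        refine (hasDerivAt_const s (0 : ℝ)).congr_of_eventuallyEq ?_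
        filter_upwards [hI.mem_nhds hs] with y hy
        exact ih k (by omega) y hy
      have e := hder.unique hz
      rw [ih (k + 1) (by omega) s hs, zero_sub, neg_eq_zero, mul_eq_zero] at e
      have e2 : N - d - 1 = N - (d + 1) := by omega
      rw [e2] at e
      rcases e with e | e
      · exfalso
        have : N - d = 0 := by exact_mod_cast e
        omega
      · exact e
  intro s hs
  have := main N le_rfl 0 (by omega) s hs
  simpa [expd] using this

theorem posPow_hasDerivAt (m : ℕ) (t : ℝ) :
    HasDerivAt (fun t : ℝ => (max t 0) ^ (m + 2)) ((m + 2 : ℝ) * (max t 0) ^ (m + 1)) t := by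
  rcases lt_trichotomy t 0 with ht | ht | ht
  · rw [max_eq_right ht.le]
    have : HasDerivAt (fun _ : ℝ => (0 : ℝ)) 0 t := hasDerivAt_const t 0
    simp only [ne_eq, Nat.add_eq_zero_iff, one_ne_zero, and_false, not_false_eq_true, zero_pow,
      mul_zero]
    refine this.congr_of_eventuallyEq ?_
    filter_upwards [gt_mem_nhds ht] with y hy
    simp [max_eq_right hy.le]
  · subst ht
    simp only [max_self, ne_eq, Nat.add_eq_zero_iff, one_ne_zero, and_false, not_false_eq_true,
      zero_pow, mul_zero]
    rw [hasDerivAt_iff_tendsto_slope]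
    have hc : Continuous (fun t : ℝ => |t| ^ (m + 1)) := by fun_prop
    have h0 := (hc.tendsto 0).mono_left (nhdsWithin_le_nhds (s := {(0 : ℝ)}ᶜ))
    simp only [abs_zero, ne_eq, Nat.add_eq_zero_iff, one_ne_zero, and_false, not_false_eq_true,
      zero_pow] at h0
    refine squeeze_zero_norm' ?_ h0
    filter_upwards [self_mem_nhdsWithin] with y hy
    have hy : y ≠ 0 := hy
    have hle : max y 0 ≤ |y| := max_le (le_abs_self y) (abs_nonneg y)
    have h2 : (max y 0) ^ (m + 2) ≤ |y| ^ (m + 2) :=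
      pow_le_pow_left₀ (le_max_right _ _) hle _
    simp only [slope_def_field, max_self, sub_zero, Real.norm_eq_abs, abs_div]
    rw [div_le_iff₀ (abs_pos.mpr hy)]
    have : (0 : ℝ) ^ (m + 2) = 0 := by simp
    rw [this, sub_zero, abs_of_nonneg (pow_nonneg (le_max_right _ _) _)]
    calc _ ≤ _ := h2
      _ = _ := by ring
  · rw [max_eq_left ht.le]
    have := hasDerivAt_pow (m + 2) t
    have h3 : HasDerivAt (fun t : ℝ => t ^ (m + 2)) ((m + 2 : ℝ) * t ^ (m + 1)) t := by
      refine this.congr_deriv ?_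
      push_cast; simp
    refine h3.congr_of_eventuallyEq ?_
    filter_upwards [lt_mem_nhds ht] with y hy
    simp [max_eq_left hy.le]

theorem posPow_contDiff (m : ℕ) : ContDiff ℝ m (fun t : ℝ => (max t 0) ^ (m + 1)) := by
  induction m with
  | zero =>
    simp only [Nat.cast_zero]
    rw [contDiff_zero]
    fun_prop
  | succ m ih =>
    push_cast
    rw [contDiff_succ_iff_deriv]
    refine ⟨fun t => (posPow_hasDerivAt m t).differentiableAt, by simp, ?_⟩
    have : deriv (fun t : ℝ => (max t 0) ^ (m + 1 + 1)) =
        fun t => (m + 2 : ℝ) * (max t 0) ^ (m + 1) := by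
      funext t
      exact (posPow_hasDerivAt m t).deriv
    rw [this]
    exact contDiff_const.mul ih

/-- Every morphism of sheaves `u : C^m → C^{m+1}` over an open `U ⊆ ℝⁿ` is zero. -/
theorem stmt_2 (n m : ℕ) (hn : 1 ≤ n)
    (U : Set (EuclideanSpace ℝ (Fin n))) (hU : IsOpen U)
    (u : SheafHom n m (m + 1) U) :
    ∀ V, V ⊆ U → IsOpen V → ∀ φ, ContDiffOn ℝ (m : ℕ∞) φ V → ∀ x ∈ V,
      u.app V φ x = 0 := by
  intro V hVU hV φ hφ x hx
  let i0 : Fin n := ⟨0, hn⟩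
  let l : EuclideanSpace ℝ (Fin n) → ℝ := fun y => y i0 - x i0
  have hl : ContDiff ℝ (m : ℕ∞) l := by
    have : ContDiff ℝ (m : ℕ∞) (fun y : EuclideanSpace ℝ (Fin n) => y i0) :=
      (EuclideanSpace.proj (𝕜 := ℝ) i0).contDiff
    exact this.sub contDiff_const
  have hlc : Continuous l := hl.continuous
  let F : ℕ → ℕ → ℝ → EuclideanSpace ℝ (Fin n) → ℝ :=
    fun i j s y => (l y - s) ^ i * l y ^ j * φ y
  have hF : ∀ i j s, ContDiffOn ℝ (m : ℕ∞) (F i j s) V := fun i j s =>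
    ((((hl.sub contDiff_const).pow i).mul (hl.pow j)).contDiffOn).mul hφ
  let W : ℕ → EuclideanSpace ℝ (Fin n) → ℝ := fun j => u.app V (F 0 j 0)
  have hexp : ∀ i j s, ∀ y ∈ V, u.app V (F i j s) y = expd W i j s y := by
    intro i
    induction i with
    | zero =>
      intro j s y _
      have : F 0 j s = F 0 j 0 := by funext z; simp [F]
      rw [this]; rfl
    | succ i ih =>
      intro j s y hy
      have e : F (i + 1) j s = F i (j + 1) s + (-s) • F i j s := by
        funext z
        simp only [F, Pi.add_apply, Pi.smul_apply, smul_eq_mul]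
        ring
      rw [e, u.map_add V hVU hV (F i (j + 1) s) ((-s) • F i j s) (hF _ _ _) ((hF i j s).const_smul (-s)) y hy,
        u.map_smul V hVU hV _ _ (hF _ _ _) y hy, ih _ _ y hy, ih _ _ y hy]
      simp only [expd]
      ring
  let p : ℝ → EuclideanSpace ℝ (Fin n) := fun t => x + t • EuclideanSpace.single i0 (1 : ℝ)
  have hpd : ∀ k : WithTop ℕ∞, ContDiff ℝ k p := fun k =>
    contDiff_const.add (contDiff_id.smul contDiff_const)
  have hlp : ∀ t, l (p t) = t := by
    intro t
    simp [l, p]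
  have hp0 : p 0 = x := by simp [p]
  have hI : IsOpen (p ⁻¹' V) := hV.preimage (hpd 0).continuous
  have hcomp : ∀ f, ContDiffOn ℝ (m : ℕ∞) f V →
      ContDiffOn ℝ ((m + 1 : ℕ) : WithTop ℕ∞) (fun t => u.app V f (p t)) (p ⁻¹' V) := by
    intro f hf
    exact (u.map_contDiffOn V hVU hV f hf).comp (hpd _).contDiffOn (fun _ h => h)
  have hexpc : ∀ i j s t, expd (fun j t => W j (p t)) i j s t = expd W i j s (p t) := by
    intro i
    induction i with
    | zero => intro j s t; rfl
    | succ i ih => intro j s t; simp only [expd, ih]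
  have hcore := core_1d (m + 1) (p ⁻¹' V) hI (fun j t => W j (p t))
    (fun j => hcomp _ (hF 0 j 0)) (by
      intro s hs
      let G : EuclideanSpace ℝ (Fin n) → ℝ := fun y => (max (l y - s) 0) ^ (m + 1) * φ y
      have hG : ContDiffOn ℝ (m : ℕ∞) G V := by
        have := (posPow_contDiff m).comp (hl.sub (contDiff_const (c := s)))
        exact this.contDiffOn.mul hφ
      refine ⟨fun t => u.app V G (p t), hcomp G hG, ?_, ?_⟩
      · intro t ht hst
        rw [hexpc, ← hexp _ _ _ _ ht]
        have hWo : IsOpen (V ∩ {y | s < l y}) := hV.inter (isOpen_lt continuous_const hlc)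
        have hmem : p t ∈ V ∩ {y | s < l y} := ⟨ht, by simpa [hlp] using hst⟩
        have hFW := (hF (m + 1) 0 s).mono (Set.inter_subset_left (t := {y | s < l y}))
        show u.app V G (p t) = u.app V (F (m + 1) 0 s) (p t)
        rw [u.restrict V hVU hV _ Set.inter_subset_left hWo G (F (m + 1) 0 s) hG hFW ?_ _ hmem,
          u.restrict V hVU hV _ Set.inter_subset_left hWo (F (m + 1) 0 s) (F (m + 1) 0 s)
            (hF _ _ _) hFW (fun _ _ => rfl) _ hmem]
        rintro y ⟨_, hy⟩
        have hy : s < l y := hy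
        simp only [G, F, max_eq_left (sub_nonneg.mpr hy.le), pow_zero, mul_one]
      · intro t ht hst
        have hWo : IsOpen (V ∩ {y | l y < s}) := hV.inter (isOpen_lt hlc continuous_const)
        have hmem : p t ∈ V ∩ {y | l y < s} := ⟨ht, by simpa [hlp] using hst⟩
        have hGW := hG.mono (Set.inter_subset_left (t := {y | l y < s}))
        have hGW0 : ContDiffOn ℝ (m : ℕ∞) ((0 : ℝ) • G) (V ∩ {y | l y < s}) :=
          hGW.const_smul (0 : ℝ)
        have hsub : V ∩ {y | l y < s} ⊆ U := Set.inter_subset_left.trans hVU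
        show u.app V G (p t) = 0
        rw [u.restrict V hVU hV _ Set.inter_subset_left hWo G ((0 : ℝ) • G) hG hGW0 ?_ _ hmem,
          u.map_smul _ hsub hWo 0 G hGW _ hmem, zero_mul]
        rintro y ⟨_, hy⟩
        have hy : l y < s := hy
        simp [G, max_eq_right (sub_nonpos.mpr hy.le)])
  have h0 := hcore 0 (by simpa [hp0] using hx)
  have hF0 : F 0 0 0 = φ := by funext y; simp [F]
  simpa [W, hp0, hF0] using h0
end

section
/- Let n ≥ 1, let m be a natural number, let U be an open subset of ℝⁿ, and let u be a morphism of sheaves from C^m to C^0 over U. If u annihilates all polynomials of degree ≤ m, i.e. for every polynomial function p : ℝⁿ → ℝ of total degree ≤ m and every open V ⊆ U one has u_V(p|_V) = 0, then u = 0: for every open V ⊆ U, every φ ∈ C^m(V) and every x ∈ V, u_V(φ)(x) = 0. -/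
open scoped BigOperators

section Aux

variable {E : Type*} [NormedAddCommGroup E] [NormedSpace ℝ E]

lemma aux_fderiv_apply {k : ℕ} {f : E → ℝ} (hf : ContDiff ℝ ((k + 1 : ℕ) : ℕ∞) f)
    (x w : E) (t : Fin k → E) :
    fderiv ℝ (fun y => iteratedFDeriv ℝ k f y t) x w
      = iteratedFDeriv ℝ (k + 1) f x (Fin.cons w t : Fin (k + 1) → E) := by
  have hd : DifferentiableAt ℝ (iteratedFDeriv ℝ k f) x :=
    (hf.differentiable_iteratedFDeriv (by exact_mod_cast Nat.lt_succ_self k)) x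
  have h := (ContinuousMultilinearMap.apply ℝ (fun _ : Fin k => E) ℝ t).hasFDerivAt.comp x
    hd.hasFDerivAt
  have h2 := h.fderiv
  rw [iteratedFDeriv_succ_apply_left]
  simp only [Fin.cons_zero, Fin.tail_cons]
  have h3 := congrArg (fun L => L w) h2
  exact h3

lemma aux_swap {k : ℕ} {f : E → ℝ} (hf : ContDiff ℝ ((k + 2 : ℕ) : ℕ∞) f)
    (x a b : E) (t : Fin k → E) :
    iteratedFDeriv ℝ (k + 2) f x (Fin.cons a (Fin.cons b t : Fin (k + 1) → E) : Fin (k + 2) → E)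
      = iteratedFDeriv ℝ (k + 2) f x
        (Fin.cons b (Fin.cons a t : Fin (k + 1) → E) : Fin (k + 2) → E) := by
  have hf1 : ContDiff ℝ ((k + 1 : ℕ) : ℕ∞) f := hf.of_le (by exact_mod_cast Nat.le_succ _)
  have hF : ContDiff ℝ 2 (fun y => iteratedFDeriv ℝ k f y t) := by
    have h1 : ContDiff ℝ 2 (iteratedFDeriv ℝ k f) := by
      apply hf.iteratedFDeriv_right
      have h2 : (((2 + k : ℕ) : ℕ∞) : WithTop ℕ∞) = ((k + 2 : ℕ) : ℕ∞) := by rw [add_comm]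
      rw [← h2]
      push_cast
      exact le_rfl
    exact (ContinuousMultilinearMap.apply ℝ (fun _ : Fin k => E) ℝ t).contDiff.comp h1
  have key : ∀ a b : E, iteratedFDeriv ℝ (k + 2) f x
      (Fin.cons a (Fin.cons b t : Fin (k + 1) → E) : Fin (k + 2) → E)
      = fderiv ℝ (fderiv ℝ (fun y => iteratedFDeriv ℝ k f y t)) x a b := by
    intro a b
    rw [← aux_fderiv_apply hf]
    have : (fun y => iteratedFDeriv ℝ (k + 1) f y (Fin.cons b t : Fin (k + 1) → E))
        = fun y => fderiv ℝ (fun y => iteratedFDeriv ℝ k f y t) y b := by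
      funext y
      rw [aux_fderiv_apply hf1]
    rw [this]
    have hd : DifferentiableAt ℝ (fderiv ℝ (fun y => iteratedFDeriv ℝ k f y t)) x :=
      ((hF.fderiv_right (m := 1) (by norm_num)).differentiable (by norm_num)) x
    have h := ((ContinuousLinearMap.apply ℝ ℝ b).hasFDerivAt.comp x hd.hasFDerivAt).fderiv
    exact congrArg (fun L => L a) h
  rw [key, key]
  exact hF.contDiffAt.isSymmSndFDerivAt (by simp) a b

lemma aux_symm (k : ℕ) : ∀ {f : E → ℝ}, ContDiff ℝ ((k : ℕ) : ℕ∞) f → ∀ (σ : Equiv.Perm (Fin k))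
    (x : E) (v : Fin k → E), iteratedFDeriv ℝ k f x (v ∘ σ) = iteratedFDeriv ℝ k f x v := by
  induction k with
  | zero => 
    intro f hf σ x v
    congr 1
    exact Subsingleton.elim _ _
  | succ k ih =>
    intro f hf σ
    have hmem : σ ∈ Submonoid.closure (Set.range fun i : Fin k ↦ Equiv.swap i.castSucc i.succ) := by
      rw [Equiv.Perm.mclosure_swap_castSucc_succ]; trivial
    induction hmem using Submonoid.closure_induction with
    | one => intro x v; rfl
    | mul a b _ _ ha hb =>
      intro x v
      have : v ∘ (a * b : Equiv.Perm _) = (v ∘ a) ∘ b := rfl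
      rw [this, hb, ha]
    | mem s hs =>
      obtain ⟨i, rfl⟩ := hs
      intro x v
      have hk : ContDiff ℝ ((k : ℕ) : ℕ∞) f := hf.of_le (by exact_mod_cast Nat.le_succ k)
      cases k with
      | zero => exact i.elim0
      | succ k =>
        induction i using Fin.cases with
        | zero =>
          have h1 : v = (Fin.cons (v 0) (Fin.cons (v 1) (Fin.tail (Fin.tail v)) : Fin (k + 1) → E) :
              Fin (k + 2) → E) := by
            ext j
            refine Fin.cases ?_ (fun j => Fin.cases ?_ (fun j => ?_) j) j <;> rfl
          have h2 : v ∘ (Equiv.swap (Fin.castSucc (0 : Fin (k + 1))) (Fin.succ 0)) =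
              (Fin.cons (v 1) (Fin.cons (v 0) (Fin.tail (Fin.tail v)) : Fin (k + 1) → E) :
              Fin (k + 2) → E) := by
            funext j
            refine Fin.cases ?_ (fun j => Fin.cases ?_ (fun j => ?_) j) j
            · simp
            · simp
            · have : Equiv.swap (Fin.castSucc (0 : Fin (k + 1))) (Fin.succ 0) j.succ.succ
                  = j.succ.succ := by
                apply Equiv.swap_apply_of_ne_of_ne
                · simp [Fin.ext_iff]
                · simp [Fin.ext_iff]
              simp only [Function.comp, this]
              rfl
          rw [h2]
          conv_rhs => rw [h1]
          exact aux_swap hf _ _ _ _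
        | succ i =>
          have h1 : v = (Fin.cons (v 0) (Fin.tail v) : Fin (k + 2) → E) := by simp
          have h2 : v ∘ (Equiv.swap (Fin.castSucc (Fin.succ i)) (Fin.succ (Fin.succ i))) =
              (Fin.cons (v 0) (Fin.tail v ∘ Equiv.swap (Fin.castSucc i) (Fin.succ i)) :
              Fin (k + 2) → E) := by
            funext j
            refine Fin.cases ?_ (fun j => ?_) j
            · have : Equiv.swap (Fin.castSucc (Fin.succ i)) (Fin.succ (Fin.succ i)) 0 = 0 := by
                apply Equiv.swap_apply_of_ne_of_ne
                · simp [Fin.ext_iff]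
                · simp [Fin.ext_iff]
              simp only [Function.comp, this]
              rfl
            · simp only [Function.comp, Fin.cons_succ, Fin.tail]
              congr 1
              simp only [Equiv.swap_apply_def, Fin.ext_iff, Fin.val_succ, Fin.val_castSucc]
              split_ifs <;> simp_all
          rw [h2]
          conv_rhs => rw [h1]
          rw [← aux_fderiv_apply hf, ← aux_fderiv_apply hf]
          congr 2
          funext y
          exact ih hk _ _ _

end Aux

lemma aux_taylor {n m : ℕ} {f : EuclideanSpace ℝ (Fin n) → ℝ} (hf : ContDiff ℝ (m : ℕ∞) f)
    (a : EuclideanSpace ℝ (Fin n)) :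
    ∃ p : MvPolynomial (Fin n) ℝ, p.totalDegree ≤ m ∧
      ContDiff ℝ (m : ℕ∞) (fun y : EuclideanSpace ℝ (Fin n) => MvPolynomial.eval (fun i => y i) p) ∧
      ∀ j ≤ m, iteratedFDeriv ℝ j
        (f - fun y : EuclideanSpace ℝ (Fin n) => MvPolynomial.eval (fun i => y i) p) a = 0 := by
  classical
  let c : (j : ℕ) → (Fin j → Fin n) → ℝ := fun j s =>
    ((j.factorial : ℝ)⁻¹) * iteratedFDeriv ℝ j f a (fun i => EuclideanSpace.single (s i) 1)
  let p : MvPolynomial (Fin n) ℝ := ∑ j ∈ Finset.range (m + 1), ∑ s : Fin j → Fin n,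
    MvPolynomial.C (c j s) * ∏ i, (MvPolynomial.X (s i) - MvPolynomial.C (a (s i)))
  let P : FormalMultilinearSeries ℝ (EuclideanSpace ℝ (Fin n)) ℝ := fun j =>
    if j ≤ m then ((j.factorial : ℝ)⁻¹) • iteratedFDeriv ℝ j f a else 0
  set T : EuclideanSpace ℝ (Fin n) → ℝ := fun y => MvPolynomial.eval (fun i => y i) p with hT
  have hbasis : ∀ y : EuclideanSpace ℝ (Fin n),
      y = ∑ i, y i • EuclideanSpace.single i (1 : ℝ) := by
    intro y
    ext k
    simp [Finset.sum_apply, Pi.single_apply]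
  have hTeq : ∀ y, (∑ j ∈ Finset.range (m + 1), P j fun _ => y) = T (a + y) := by
    intro y
    simp only [hT, p, map_sum, map_mul, map_prod, map_sub, MvPolynomial.eval_C,
      MvPolynomial.eval_X]
    refine Finset.sum_congr rfl fun j hj => ?_
    have hj' : j ≤ m := by simpa [Nat.lt_succ_iff] using hj
    simp only [P, if_pos hj']
    rw [_root_.smul_apply]
    conv_lhs => rw [hbasis y]
    rw [ContinuousMultilinearMap.map_sum]
    rw [smul_eq_mul, Finset.mul_sum]
    refine Finset.sum_congr rfl fun s _ => ?_
    rw [ContinuousMultilinearMap.map_smul_univ]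
    simp only [c, PiLp.add_apply, add_sub_cancel_left, smul_eq_mul]
    ring
  have hP : HasFiniteFPowerSeriesOnBall T P a (m + 1) ⊤ := by
    apply HasFiniteFPowerSeriesOnBall.mk'
    · intro k hk
      simp only [P]
      rw [if_neg (by omega)]
    · simp
    · intro y _
      exact hTeq y
  have hTc : ContDiff ℝ (m : ℕ∞) T := by
    have h := hP.cpolynomialOn.analyticOnNhd.contDiffOn (n := ((m : ℕ∞) : WithTop ℕ∞))
      (by simp)
    simpa [contDiffOn_univ] using h
  refine ⟨p, ?_, hTc, ?_⟩
  · refine MvPolynomial.totalDegree_finsetSum_le fun j hj => ?_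
    refine MvPolynomial.totalDegree_finsetSum_le fun s _ => ?_
    have hj' : j ≤ m := by simpa [Nat.lt_succ_iff] using hj
    refine (MvPolynomial.totalDegree_mul _ _).trans ?_
    rw [MvPolynomial.totalDegree_C, zero_add]
    refine (MvPolynomial.totalDegree_finsetProd _ _).trans ?_
    refine (Finset.sum_le_card_nsmul _ _ 1 ?_).trans (by simpa using hj')
    intro i _
    refine (MvPolynomial.totalDegree_sub _ _).trans ?_
    simp
  · intro j hj
    have hfj : ContDiff ℝ (j : ℕ∞) f := hf.of_le (by exact_mod_cast hj)
    have hTj : ContDiff ℝ (j : ℕ∞) T := hTc.of_le (by exact_mod_cast hj)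
    rw [iteratedFDeriv_sub_apply (by exact hfj.contDiffAt) (by exact hTj.contDiffAt), sub_eq_zero]
    ext v
    rw [hP.toHasFPowerSeriesOnBall.iteratedFDeriv_eq_sum_of_completeSpace]
    simp only [P, if_pos hj, _root_.smul_apply]
    have : ∀ σ : Equiv.Perm (Fin j), iteratedFDeriv ℝ j f a (fun i => v (σ i))
      = iteratedFDeriv ℝ j f a v := fun σ => aux_symm j hfj σ a v
    simp only [this]
    simp [Finset.card_univ, Fintype.card_perm]
    field_simp

lemma aux_decay {E : Type*} [NormedAddCommGroup E] [NormedSpace ℝ E] {m : ℕ} {g : E → ℝ}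
    (hg : ContDiff ℝ (m : ℕ∞) g) (a : E) (h0 : ∀ j ≤ m, iteratedFDeriv ℝ j g a = 0)
    {ε : ℝ} (hε : 0 < ε) :
    ∃ δ > 0, ∀ i ≤ m, ∀ x, ‖x - a‖ < δ →
      ‖iteratedFDeriv ℝ (m - i) g x‖ ≤ ε * ‖x - a‖ ^ i := by
  have hc : Continuous (iteratedFDeriv ℝ m g) := hg.continuous_iteratedFDeriv le_rfl
  obtain ⟨δ, hδ, h⟩ := Metric.continuous_iff.1 hc a ε hε
  refine ⟨δ, hδ, ?_⟩
  intro i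
  induction i with
  | zero =>
    intro _ x hx
    have := h x (by rwa [dist_eq_norm])
    rw [dist_eq_norm, h0 m le_rfl, sub_zero] at this
    simpa using this.le
  | succ i ih =>
    intro hi x hx
    have hconv := convex_closedBall a ‖x - a‖
    have hk : m - i = (m - (i + 1)) + 1 := by omega
    have hlt : m - (i + 1) < m := by omega
    have hb := hconv.norm_image_sub_le_of_norm_fderiv_le (𝕜 := ℝ)
      (f := iteratedFDeriv ℝ (m - (i + 1)) g) (C := ε * ‖x - a‖ ^ i) (x := a) (y := x)
      (fun y _ => (hg.differentiable_iteratedFDeriv (WithTop.coe_lt_coe.2 (Nat.cast_lt.2 hlt))) y)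
      (fun y hy => by
        rw [norm_fderiv_iteratedFDeriv, ← hk]
        have hy' : ‖y - a‖ ≤ ‖x - a‖ := by simpa [dist_eq_norm] using hy
        refine (ih (by omega) y (hy'.trans_lt hx)).trans ?_
        gcongr)
      (by simp) (by simp [dist_eq_norm])
    rw [h0 _ (by omega), sub_zero] at hb
    rw [pow_succ, ← mul_assoc]
    exact hb

lemma aux_bound {E : Type*} [NormedAddCommGroup E] [NormedSpace ℝ E] [FiniteDimensional ℝ E]
    {m : ℕ} {g χ : E → ℝ}
    (hg : ContDiff ℝ (m : ℕ∞) g) (a e : E) (he : ‖e‖ = 1) (h0 : ∀ j ≤ m, iteratedFDeriv ℝ j g a = 0)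
    (hχ : ContDiff ℝ (m : ℕ∞) χ) (hχs : tsupport χ ⊆ Metric.closedBall 0 (1 / 2))
    {ε : ℝ} (hε : 0 < ε) :
    ∃ δ > 0, ∀ t : ℝ, 0 < t → t < δ → ∀ k ≤ m, ∀ x,
      ‖iteratedFDeriv ℝ k (fun y => χ (t⁻¹ • (y - (a + t • e))) * g y) x‖ ≤ ε := by
  have hcs : HasCompactSupport χ :=
    (isCompact_closedBall (0 : E) (1 / 2)).of_isClosed_subset (isClosed_tsupport _) hχs
  obtain ⟨C, hC0, hC⟩ : ∃ C : ℝ, 0 < C ∧ ∀ i ≤ m, ∀ x, ‖iteratedFDeriv ℝ i χ x‖ ≤ C := by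
    have : ∀ i : ℕ, ∃ C : ℝ, 0 ≤ C ∧ (i ≤ m → ∀ x, ‖iteratedFDeriv ℝ i χ x‖ ≤ C) := by
      intro i
      by_cases hi : i ≤ m
      · obtain ⟨C, hC⟩ := (hcs.iteratedFDeriv i (𝕜 := ℝ)).exists_bound_of_continuous
          (hχ.continuous_iteratedFDeriv (by exact_mod_cast hi))
        exact ⟨C, (norm_nonneg _).trans (hC 0), fun _ => hC⟩
      · exact ⟨0, le_rfl, fun h => absurd h hi⟩
    choose C hC0 hC using this
    refine ⟨1 + ∑ i ∈ Finset.range (m + 1), C i, ?_, ?_⟩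
    · have := Finset.sum_nonneg (s := Finset.range (m + 1)) (fun i _ => hC0 i)
      linarith
    · intro i hi x
      have := Finset.single_le_sum (s := Finset.range (m + 1)) (f := C) (fun i _ => hC0 i)
        (Finset.mem_range.2 (Nat.lt_succ_of_le hi))
      linarith [hC i hi x]
  set K : ℝ := 2 ^ m * C * 2 ^ m with hK
  have hKpos : 0 < K := by positivity
  obtain ⟨δ, hδ, hd⟩ := aux_decay hg a h0 (ε := ε / K) (by positivity)
  refine ⟨min 1 (δ / 2), by positivity, ?_⟩
  intro t ht htδ k hk x
  have ht1 : t ≤ 1 := htδ.le.trans (min_le_left _ _)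
  have ht2 : 2 * t < δ := by
    have := htδ.trans_le (min_le_right _ _)
    linarith
  set χt : E → ℝ := fun y => χ (t⁻¹ • (y - (a + t • e))) with hχt
  have hχtc : ContDiff ℝ (m : ℕ∞) χt := by
    apply hχ.comp
    fun_prop
  have hder : ∀ i ≤ m, ‖iteratedFDeriv ℝ i χt x‖ ≤
      ‖iteratedFDeriv ℝ i χ (t⁻¹ • (x - (a + t • e)))‖ * (t⁻¹) ^ i := by
    intro i hi
    have e1 : iteratedFDeriv ℝ i χt x
        = iteratedFDeriv ℝ i (χ ∘ (t⁻¹ • ContinuousLinearMap.id ℝ E)) (x - (a + t • e)) :=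
      iteratedFDeriv_comp_sub (f := χ ∘ (t⁻¹ • ContinuousLinearMap.id ℝ E)) i (a + t • e) x
    rw [e1, ContinuousLinearMap.iteratedFDeriv_comp_right _ hχ _ (by exact_mod_cast hi)]
    refine (ContinuousMultilinearMap.norm_compContinuousLinearMap_le _ _).trans ?_
    have : ‖(t⁻¹ • ContinuousLinearMap.id ℝ E)‖ ≤ t⁻¹ := by
      rw [norm_smul]
      rw [Real.norm_of_nonneg (by positivity)]
      have := ContinuousLinearMap.norm_id_le (𝕜 := ℝ) (E := E)
      nlinarith [inv_pos.2 ht]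
    simp only [Finset.prod_const, Finset.card_univ, Fintype.card_fin]
    gcongr
    · simp
  by_cases hx : ‖x - a‖ ≤ 2 * t
  · have hterm : ∀ i ∈ Finset.range (k + 1), (k.choose i : ℝ) * ‖iteratedFDeriv ℝ i χt x‖ *
        ‖iteratedFDeriv ℝ (k - i) g x‖ ≤ (k.choose i : ℝ) * (C * (ε / K) * 2 ^ m) := by
      intro i hi
      have hik : i ≤ k := by simpa [Nat.lt_succ_iff] using hi
      have h1 := (hder i (hik.trans hk)).trans
        (mul_le_mul_of_nonneg_right (hC i (hik.trans hk) _) (by positivity))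
      have h2 := hd (m - (k - i)) (by omega) x (hx.trans_lt ht2)
      have h3 : m - (m - (k - i)) = k - i := by omega
      rw [h3] at h2
      have h4 : ‖x - a‖ ^ (m - (k - i)) ≤ 2 ^ m * t ^ i := by
        calc ‖x - a‖ ^ (m - (k - i)) ≤ (2 * t) ^ (m - (k - i)) := by gcongr
          _ = 2 ^ (m - (k - i)) * t ^ (m - (k - i)) := mul_pow _ _ _
          _ ≤ 2 ^ m * t ^ i := by
            gcongr ?_ * ?_
            · exact pow_le_pow_right₀ (by norm_num) (by omega)
            · exact pow_le_pow_of_le_one ht.le ht1 (by omega)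
      rw [mul_assoc]
      refine mul_le_mul_of_nonneg_left ?_ (by positivity)
      calc ‖iteratedFDeriv ℝ i χt x‖ * ‖iteratedFDeriv ℝ (k - i) g x‖
          ≤ (C * (t⁻¹) ^ i) * ((ε / K) * (2 ^ m * t ^ i)) := by
            gcongr
            exact h2.trans (by gcongr)
        _ = C * (ε / K) * 2 ^ m := by
            rw [inv_pow]
            field_simp
    refine (norm_iteratedFDeriv_mul_le hχtc hg x (by exact_mod_cast hk)).trans ?_
    refine (Finset.sum_le_sum hterm).trans ?_
    rw [← Finset.sum_mul, ← Nat.cast_sum, Nat.sum_range_choose]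
    have : ((2 ^ k : ℕ) : ℝ) ≤ 2 ^ m := by
      push_cast
      exact pow_le_pow_right₀ (by norm_num) hk
    calc ((2 ^ k : ℕ) : ℝ) * (C * (ε / K) * 2 ^ m) ≤ 2 ^ m * (C * (ε / K) * 2 ^ m) := by gcongr
      _ = ε := by
        rw [hK]
        field_simp
  · have hz : ∀ i, iteratedFDeriv ℝ i χ (t⁻¹ • (x - (a + t • e))) = 0 := by
      intro i
      by_contra hne
      have hm := hχs (support_iteratedFDeriv_subset (𝕜 := ℝ) i (Function.mem_support.2 hne))
      rw [mem_closedBall_zero_iff, norm_smul, norm_inv, Real.norm_of_nonneg ht.le] at hm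
      have h5 : ‖x - (a + t • e)‖ ≤ t * (1 / 2) := by
        rw [inv_mul_le_iff₀ ht] at hm
        exact hm
      have h6 : ‖x - a‖ ≤ ‖x - (a + t • e)‖ + ‖t • e‖ := by
        have : x - a = (x - (a + t • e)) + t • e := by abel
        rw [this]
        exact norm_add_le _ _
      rw [norm_smul, he, Real.norm_of_nonneg ht.le] at h6
      linarith
    refine (norm_iteratedFDeriv_mul_le hχtc hg x (by exact_mod_cast hk)).trans ?_
    rw [Finset.sum_eq_zero]
    · exact hε.le
    · intro i hi
      have hik : i ≤ k := by simpa [Nat.lt_succ_iff] using hi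
      have h1 := hder i (hik.trans hk)
      rw [hz, norm_zero, zero_mul] at h1
      have h2 : ‖iteratedFDeriv ℝ i χt x‖ = 0 := le_antisymm h1 (norm_nonneg _)
      rw [h2]
      simp

lemma aux_glue {E : Type*} [NormedAddCommGroup E] [NormedSpace ℝ E] [FiniteDimensional ℝ E]
    {m : ℕ} {g : E → ℝ}
    (hg : ContDiff ℝ (m : ℕ∞) g) (a e : E) (he : ‖e‖ = 1)
    (h0 : ∀ j ≤ m, iteratedFDeriv ℝ j g a = 0) :
    ∃ (t : ℕ → ℝ) (ψ : E → ℝ), (∀ l, 0 < t l) ∧ Filter.Tendsto t Filter.atTop (nhds 0) ∧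
      ContDiff ℝ (m : ℕ∞) ψ ∧ (∀ l, ∀ x ∈ Metric.ball (a + t l • e) (t l / 4), ψ x = g x) ∧
      (∀ l, ∀ x ∈ Metric.ball (a - t l • e) (t l / 4), ψ x = 0) := by
  let χ : ContDiffBump (0 : E) := ⟨1 / 4, 1 / 2, by norm_num, by norm_num⟩
  have hχ : ContDiff ℝ (m : ℕ∞) χ := χ.contDiff
  have hχs : tsupport χ ⊆ Metric.closedBall 0 (1 / 2) := by rw [χ.tsupport_eq]
  let τ : ℕ → ℝ := fun N => (1 / 4 : ℝ) ^ N
  have hτ : Filter.Tendsto τ Filter.atTop (nhds 0) :=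
    tendsto_pow_atTop_nhds_zero_of_lt_one (by norm_num) (by norm_num)
  have hτpos : ∀ N, 0 < τ N := fun N => by positivity
  have hev : ∀ l : ℕ, ∀ᶠ N in Filter.atTop, ∀ k ≤ m, ∀ x, ‖iteratedFDeriv ℝ k
      (fun y => χ ((τ N)⁻¹ • (y - (a + τ N • e))) * g y) x‖ ≤ (1 / 2 : ℝ) ^ l := by
    intro l
    obtain ⟨δ, hδ, h⟩ := aux_bound hg a e he h0 hχ hχs (ε := (1 / 2 : ℝ) ^ l) (by positivity)
    filter_upwards [hτ.eventually_lt_const hδ] with N hN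
    exact h (τ N) (hτpos N) hN
  obtain ⟨ν, hν, hb⟩ := Filter.extraction_forall_of_eventually hev
  let t : ℕ → ℝ := fun l => τ (ν l)
  have ht : ∀ l, 0 < t l := fun l => hτpos _
  let F : ℕ → E → ℝ := fun l y => χ ((t l)⁻¹ • (y - (a + t l • e))) * g y
  have hF0 : ∀ l x, t l / 2 ≤ ‖x - (a + t l • e)‖ → F l x = 0 := by
    intro l x hx
    have : χ ((t l)⁻¹ • (x - (a + t l • e))) = 0 := by
      apply χ.zero_of_le_dist
      rw [dist_zero_right, norm_smul, norm_inv, Real.norm_of_nonneg (ht l).le,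
        le_inv_mul_iff₀ (ht l)]
      change t l * (1 / 2) ≤ _
      linarith
    simp [F, this]
  have hF1 : ∀ l x, ‖x - (a + t l • e)‖ ≤ t l / 4 → F l x = g x := by
    intro l x hx
    have : χ ((t l)⁻¹ • (x - (a + t l • e))) = 1 := by
      apply χ.one_of_mem_closedBall
      rw [mem_closedBall_zero_iff, norm_smul, norm_inv, Real.norm_of_nonneg (ht l).le,
        inv_mul_le_iff₀ (ht l)]
      change _ ≤ t l * (1 / 4)
      linarith
    simp [F, this]
  have hte : ∀ l, ‖t l • e‖ = t l := by
    intro l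
    rw [norm_smul, he, Real.norm_of_nonneg (ht l).le, mul_one]
  have hsep : ∀ l l', l < l' → t l' ≤ t l / 4 := by
    intro l l' hl
    have h1 : ν l + 1 ≤ ν l' := hν hl
    calc t l' ≤ (1 / 4 : ℝ) ^ (ν l + 1) :=
          pow_le_pow_of_le_one (by norm_num) (by norm_num) h1
      _ = t l / 4 := by simp only [t, τ]; ring
  refine ⟨t, fun x => ∑' l, F l x, ht, hτ.comp hν.tendsto_atTop, ?_, ?_, ?_⟩
  · refine contDiff_tsum (N := (m : ℕ∞)) (v := fun _ l => (1 / 2 : ℝ) ^ l) ?_ ?_ ?_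
    · intro l
      refine ContDiff.mul ?_ hg
      apply hχ.comp
      fun_prop
    · intro k _
      exact summable_geometric_of_lt_one (by norm_num) (by norm_num)
    · intro k l x hk
      exact hb l k (by exact_mod_cast hk) x
  · intro l x hx
    rw [Metric.mem_ball, dist_eq_norm] at hx
    change ∑' l, F l x = g x
    rw [tsum_eq_single l]
    · exact hF1 l x hx.le
    · intro l' hl
      apply hF0
      have e1 : (t l - t l') • e = (x - (a + t l' • e)) - (x - (a + t l • e)) := by
        rw [sub_smul]; abel
      have e2 := norm_sub_le (x - (a + t l' • e)) (x - (a + t l • e))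
      rw [← e1, norm_smul, he, mul_one, Real.norm_eq_abs] at e2
      have h1 := ht l
      have h2 := ht l'
      rcases lt_or_gt_of_ne hl with h | h
      · have := hsep _ _ h
        have h3 := neg_le_abs (t l - t l')
        linarith
      · have := hsep _ _ h
        have h3 := le_abs_self (t l - t l')
        linarith
  · intro l x hx
    rw [Metric.mem_ball, dist_eq_norm] at hx
    change ∑' l, F l x = 0
    have : ∀ l', F l' x = 0 := by
      intro l'
      apply hF0
      have e1 : (t l + t l') • e = (x - (a - t l • e)) - (x - (a + t l' • e)) := by
        rw [add_smul]; abel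
      have e2 := norm_sub_le (x - (a - t l • e)) (x - (a + t l' • e))
      have h1 := ht l
      have h2 := ht l'
      rw [← e1, norm_smul, he, mul_one, Real.norm_of_nonneg (by linarith)] at e2
      linarith
    simp [this]

lemma aux_global {E : Type*} [NormedAddCommGroup E] [NormedSpace ℝ E] [FiniteDimensional ℝ E]
    {m : ℕ} {φ : E → ℝ} {V : Set E} (hV : IsOpen V) (hφ : ContDiffOn ℝ (m : ℕ∞) φ V)
    {a : E} (ha : a ∈ V) :
    ∃ (g : E → ℝ) (r : ℝ), 0 < r ∧ Metric.ball a r ⊆ V ∧ ContDiff ℝ (m : ℕ∞) g ∧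
      ∀ x ∈ Metric.ball a r, φ x = g x := by
  obtain ⟨R, hR, hRV⟩ := Metric.isOpen_iff.1 hV a ha
  let χ : ContDiffBump a := ⟨R / 4, R / 2, by positivity, by linarith⟩
  refine ⟨fun x => χ x * φ x, R / 4, by positivity,
    (Metric.ball_subset_ball (by linarith)).trans hRV, ?_, ?_⟩
  · rw [contDiff_iff_contDiffAt]
    intro x
    by_cases hx : x ∈ V
    · exact χ.contDiffAt.mul (hφ.contDiffAt (hV.mem_nhds hx))
    · have hx' : x ∉ tsupport χ := by
        rw [χ.tsupport_eq]
        intro h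
        apply hx
        apply hRV
        refine Metric.closedBall_subset_ball ?_ h
        change R / 2 < R
        linarith
      have h1 : (fun x => χ x * φ x) =ᶠ[nhds x] fun _ => 0 := by
        filter_upwards [notMem_tsupport_iff_eventuallyEq.1 hx'] with y hy
        simp [hy]
      exact contDiffAt_const.congr_of_eventuallyEq h1
  · intro x hx
    have : χ x = 1 := χ.one_of_mem_closedBall (Metric.ball_subset_closedBall hx)
    simp [this]

/-- If a morphism of sheaves `u : C^m → C^0` over an open `U ⊆ ℝⁿ` annihilates all
polynomials of total degree `≤ m`, then `u = 0`. -/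
theorem stmt_5 (n m : ℕ) (hn : 1 ≤ n)
    (U : Set (EuclideanSpace ℝ (Fin n))) (hU : IsOpen U)
    (u : SheafHom n m 0 U)
    (hpoly : ∀ p : MvPolynomial (Fin n) ℝ, p.totalDegree ≤ m →
      ∀ V, V ⊆ U → IsOpen V → ∀ x ∈ V,
        u.app V (fun y => MvPolynomial.eval (fun i => y i) p) x = 0) :
    ∀ V, V ⊆ U → IsOpen V → ∀ φ, ContDiffOn ℝ (m : ℕ∞) φ V → ∀ x ∈ V,
      u.app V φ x = 0 := by

  intro V hVU hV φ hφ a ha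
  obtain ⟨f, r, hr, hrV, hf, hfe⟩ := aux_global hV hφ ha
  obtain ⟨p, hp, hpc, hflat⟩ := aux_taylor hf a
  set T : EuclideanSpace ℝ (Fin n) → ℝ := fun y => MvPolynomial.eval (fun i => y i) p with hT
  have hg : ContDiff ℝ (m : ℕ∞) (f - T) := hf.sub hpc
  obtain ⟨t, ψ, ht, htt, hψ, h1, h2⟩ := aux_glue hg a (EuclideanSpace.single (⟨0, hn⟩ : Fin n) 1)
    (by simp) hflat
  set e : EuclideanSpace ℝ (Fin n) := EuclideanSpace.single (⟨0, hn⟩ : Fin n) 1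
  set g := f - T with hgdef
  have hcont : ∀ F : EuclideanSpace ℝ (Fin n) → ℝ, ContDiff ℝ (m : ℕ∞) F →
      ContinuousAt (u.app V F) a := fun F hF =>
    (u.map_contDiffOn V hVU hV F hF.contDiffOn).continuousOn.continuousAt (hV.mem_nhds ha)
  have hp1 : Filter.Tendsto (fun l => a + t l • e) Filter.atTop (nhds a) := by
    simpa using (tendsto_const_nhds (x := a)).add (htt.smul_const e)
  have hp2 : Filter.Tendsto (fun l => a - t l • e) Filter.atTop (nhds a) := by
    simpa using (tendsto_const_nhds (x := a)).sub (htt.smul_const e)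
  have hloc : ∀ F G : EuclideanSpace ℝ (Fin n) → ℝ, ContDiff ℝ (m : ℕ∞) F →
      ContDiff ℝ (m : ℕ∞) G → ∀ c ρ, 0 < ρ → (∀ x ∈ Metric.ball c ρ, F x = G x) → c ∈ V →
      u.app V F c = u.app V G c := by
    intro F G hF hG c ρ hρ hFG hc
    have hW : IsOpen (V ∩ Metric.ball c ρ) := hV.inter Metric.isOpen_ball
    have hcW : c ∈ V ∩ Metric.ball c ρ := ⟨hc, Metric.mem_ball_self hρ⟩
    rw [u.restrict V hVU hV _ Set.inter_subset_left hW F G hF.contDiffOn hG.contDiffOn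
      (fun x hx => hFG x hx.2) c hcW,
      u.restrict V hVU hV _ Set.inter_subset_left hW G G hG.contDiffOn hG.contDiffOn
      (fun x hx => rfl) c hcW]
  have hzc : ContDiff ℝ (m : ℕ∞) (fun _ : EuclideanSpace ℝ (Fin n) => (0 : ℝ)) := contDiff_const
  have hz : ∀ x ∈ V, u.app V (fun _ => 0) x = 0 := by
    intro x hx
    have h := u.map_smul V hVU hV 0 (fun _ => 0) hzc.contDiffOn x hx
    rw [zero_mul, zero_smul] at h
    exact h
  have k1 : u.app V ψ a = u.app V g a := by
    refine tendsto_nhds_unique_of_eventuallyEq ((hcont ψ hψ).tendsto.comp hp1)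
      ((hcont g hg).tendsto.comp hp1) ?_
    filter_upwards [hp1.eventually (hV.mem_nhds ha)] with l hl
    exact hloc ψ g hψ hg _ (t l / 4) (by linarith [ht l]) (h1 l) hl
  have k2 : u.app V ψ a = 0 := by
    refine tendsto_nhds_unique_of_eventuallyEq ((hcont ψ hψ).tendsto.comp hp2)
      tendsto_const_nhds ?_
    filter_upwards [hp2.eventually (hV.mem_nhds ha)] with l hl
    exact (hloc ψ (fun _ => 0) hψ hzc _ (t l / 4) (by linarith [ht l]) (h2 l) hl).trans (hz _ hl)
  have k3 : u.app V f a = u.app V g a + u.app V T a := by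
    rw [← u.map_add V hVU hV g T hg.contDiffOn hpc.contDiffOn a ha, hgdef, sub_add_cancel]
  have k4 : u.app V φ a = u.app V f a := by
    have haW := Metric.mem_ball_self (x := a) hr
    rw [u.restrict V hVU hV _ hrV Metric.isOpen_ball φ f hφ hf.contDiffOn hfe a haW,
      u.restrict V hVU hV _ hrV Metric.isOpen_ball f f hf.contDiffOn hf.contDiffOn
        (fun x hx => rfl) a haW]
  rw [k4, k3, ← k1, k2, hpoly p hp V hVU hV a ha, add_zero]
end

section
/- Let n ≥ 1, let m be a natural number, let U be an open neighborhood of 0 in ℝⁿ, and let u be a morphism of sheaves from C^m to C^0 over U. If φ ∈ C^m(U) satisfies (∂^α φ)(0) = 0 for every multi-index α with |α| ≤ m, then u_U(φ)(0) = 0. (In other words, u maps the subsheaf 𝔐^m_0 of C^m-functions whose derivatives of order ≤ m all vanish at 0 into the subsheaf 𝔐^0_0 of continuous functions vanishing at 0.) -/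
open scoped BigOperators

open scoped Topology ContDiff
open Asymptotics Filter

/-- Iterated partial derivatives along a list of coordinate directions. -/
noncomputable def DL (n : ℕ) (l : List (Fin n)) (f : EuclideanSpace ℝ (Fin n) → ℝ) :
    EuclideanSpace ℝ (Fin n) → ℝ :=
  l.foldr (fun i g => pderivE n i g) f

lemma DL_append (n : ℕ) (l l' : List (Fin n)) (f : EuclideanSpace ℝ (Fin n) → ℝ) :
    DL n (l ++ l') f = DL n l (DL n l' f) := by
  simp [DL, List.foldr_append]

lemma DL_replicate (n k : ℕ) (i : Fin n) (f : EuclideanSpace ℝ (Fin n) → ℝ) :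
    DL n (List.replicate k i) f = (pderivE n i)^[k] f := by
  induction k with
  | zero => rfl
  | succ k ih =>
    rw [Function.iterate_succ_apply', ← ih]; rfl

lemma partialD_eq_DL (n : ℕ) (α : Fin n → ℕ) (f : EuclideanSpace ℝ (Fin n) → ℝ) :
    partialD n α f = DL n ((List.finRange n).flatMap (fun i => List.replicate (α i) i)) f := by
  unfold partialD
  induction List.finRange n with
  | nil => rfl
  | cons a t ih =>
    rw [List.flatMap_cons, DL_append, ← ih, DL_replicate, List.foldr_cons]

lemma pderiv_contDiffOn {n : ℕ} {U : Set (EuclideanSpace ℝ (Fin n))} (hU : IsOpen U) (k : ℕ)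
    (i : Fin n) {f : EuclideanSpace ℝ (Fin n) → ℝ} (hf : ContDiffOn ℝ ((k + 1 : ℕ) : ℕ∞) f U) :
    ContDiffOn ℝ (k : ℕ∞) (pderivE n i f) U := by
  have h : ContDiffOn ℝ ((k : ℕ∞) + 1 : ℕ∞ω) f U := by
    refine hf.of_le (le_of_eq ?_); push_cast; rfl
  exact ((contDiffOn_succ_iff_fderiv_of_isOpen hU).1 h).2.2.clm_apply contDiffOn_const

lemma pderiv_eqOn {n : ℕ} {U : Set (EuclideanSpace ℝ (Fin n))} (hU : IsOpen U)
    (i : Fin n) {f g : EuclideanSpace ℝ (Fin n) → ℝ} (h : Set.EqOn f g U) :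
    Set.EqOn (pderivE n i f) (pderivE n i g) U := by
  intro x hx
  have : f =ᶠ[𝓝 x] g := h.eventuallyEq_of_mem (hU.mem_nhds hx)
  simp only [pderivE, this.fderiv_eq]

lemma DL_contDiffOn {n : ℕ} {U : Set (EuclideanSpace ℝ (Fin n))} (hU : IsOpen U) 
    (l : List (Fin n)) : ∀ (k : ℕ) {f : EuclideanSpace ℝ (Fin n) → ℝ}
    (_ : ContDiffOn ℝ ((k + l.length : ℕ) : ℕ∞) f U),
    ContDiffOn ℝ (k : ℕ∞) (DL n l f) U := by
  induction l with
  | nil => intro k f hf; exact hf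
  | cons a t ih =>
    intro k f hf
    refine pderiv_contDiffOn hU k a (ih (k+1) ?_)
    have e : k + 1 + t.length = k + (a :: t).length := by simp only [List.length_cons]; omega
    rw [e]; exact hf

lemma pderiv_comm {n : ℕ} {U : Set (EuclideanSpace ℝ (Fin n))} (hU : IsOpen U)
    (i j : Fin n) {f : EuclideanSpace ℝ (Fin n) → ℝ} (h : ContDiffOn ℝ ((2 : ℕ) : ℕ∞) f U) :
    Set.EqOn (pderivE n i (pderivE n j f)) (pderivE n j (pderivE n i f)) U := by
  intro x hx
  have h2 : ContDiffAt ℝ 2 f x := (h.contDiffAt (hU.mem_nhds hx))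
  have hs := h2.isSymmSndFDerivAt (by simp)
  have hd : DifferentiableAt ℝ (fderiv ℝ f) x :=
    (h2.fderiv_right (m := 1) (by norm_num)).differentiableAt (by simp)
  have key : ∀ v w, fderiv ℝ (fun y => fderiv ℝ f y v) x w = fderiv ℝ (fderiv ℝ f) x w v := by
    intro v w
    rw [fderiv_clm_apply hd (differentiableAt_const v)]
    simp
  show fderiv ℝ (fun y => fderiv ℝ f y _) x _ = fderiv ℝ (fun y => fderiv ℝ f y _) x _
  rw [key, key, hs.eq]

lemma DL_perm {n : ℕ} {U : Set (EuclideanSpace ℝ (Fin n))} (hU : IsOpen U) 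
    {l l' : List (Fin n)} (p : l.Perm l') {f : EuclideanSpace ℝ (Fin n) → ℝ}
    (hf : ContDiffOn ℝ ((l.length : ℕ) : ℕ∞) f U) : Set.EqOn (DL n l f) (DL n l' f) U := by
  induction p with
  | nil => exact fun _ _ => rfl
  | cons a p ih =>
    refine pderiv_eqOn hU a (ih (hf.of_le ?_))
    simp
  | swap a b t =>
    refine pderiv_comm hU b a (DL_contDiffOn hU t 2 ?_)
    convert hf using 4
    simp; ring
  | trans p q ih1 ih2 =>
    exact (ih1 hf).trans (ih2 (by rwa [← p.length_eq]))

/-- `m`-flat functions. -/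
def FlatOn {n : ℕ} (U : Set (EuclideanSpace ℝ (Fin n))) (m : ℕ)
    (f : EuclideanSpace ℝ (Fin n) → ℝ) : Prop :=
  ContDiffOn ℝ (m : ℕ∞) f U ∧ ∀ l : List (Fin n), l.length ≤ m → DL n l f 0 = 0

lemma FlatOn.pderiv {n : ℕ} {U : Set (EuclideanSpace ℝ (Fin n))} (hU : IsOpen U) {m : ℕ}
    {f : EuclideanSpace ℝ (Fin n) → ℝ} (h : FlatOn U (m + 1) f) (i : Fin n) :
    FlatOn U m (pderivE n i f) := by
  refine ⟨pderiv_contDiffOn hU m i h.1, fun l hl => ?_⟩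
  have := h.2 (l ++ [i]) (by simp; omega)
  rwa [DL_append] at this

lemma FlatOn.mono {n : ℕ} {U : Set (EuclideanSpace ℝ (Fin n))} {m k : ℕ} (hk : k ≤ m)
    {f : EuclideanSpace ℝ (Fin n) → ℝ} (h : FlatOn U m f) : FlatOn U k f :=
  ⟨h.1.of_le (by exact_mod_cast hk), fun l hl => h.2 l (hl.trans hk)⟩

lemma flatOn_of_partialD {n : ℕ} {U : Set (EuclideanSpace ℝ (Fin n))} (hU : IsOpen U)
    (hU0 : (0 : EuclideanSpace ℝ (Fin n)) ∈ U) {m : ℕ} {f : EuclideanSpace ℝ (Fin n) → ℝ}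
    (hf : ContDiffOn ℝ (m : ℕ∞) f U)
    (hvan : ∀ α : Fin n → ℕ, (∑ i, α i) ≤ m → partialD n α f 0 = 0) : FlatOn U m f := by
  refine ⟨hf, fun l hl => ?_⟩
  have p : l.Perm ((List.finRange n).flatMap (fun i => List.replicate (l.count i) i)) := by
    rw [List.perm_iff_count]
    intro a
    rw [List.count_flatMap]
    have : (List.count a ∘ fun i => List.replicate (List.count i l) i)
      = fun i => if i = a then List.count a l else 0 := by
      funext i
      by_cases h : i = a
      · subst h; simp
      · simp [List.count_replicate, h]
    rw [this, ← Fin.sum_univ_def]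
    simp
  rw [DL_perm hU p (hf.of_le (by exact_mod_cast hl)) hU0, ← partialD_eq_DL]
  apply hvan
  refine le_trans (le_of_eq ?_) hl
  rw [p.length_eq, List.length_flatMap, Fin.sum_univ_def]
  simp

lemma fderiv_apply_sum {n : ℕ} (L : EuclideanSpace ℝ (Fin n) →L[ℝ] ℝ)
    (v : EuclideanSpace ℝ (Fin n)) : L v = ∑ i, v i * L (EuclideanSpace.single i 1) := by
  conv_lhs => rw [← (EuclideanSpace.basisFun (Fin n) ℝ).sum_repr v]
  simp

lemma norm_le_sum_single {n : ℕ} (L : EuclideanSpace ℝ (Fin n) →L[ℝ] ℝ) :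
    ‖L‖ ≤ ∑ i, ‖L (EuclideanSpace.single i 1)‖ := by
  refine L.opNorm_le_bound (by positivity) fun v => ?_
  rw [fderiv_apply_sum L v, Finset.sum_mul]
  refine (norm_sum_le _ _).trans (Finset.sum_le_sum fun i _ => ?_)
  rw [norm_mul, mul_comm]
  gcongr
  exact PiLp.norm_apply_le v i

lemma FlatOn.isLittleO {n : ℕ} {U : Set (EuclideanSpace ℝ (Fin n))} (hU : IsOpen U)
    (hU0 : (0 : EuclideanSpace ℝ (Fin n)) ∈ U) {m : ℕ} : ∀ {f : EuclideanSpace ℝ (Fin n) → ℝ},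
    FlatOn U m f → f =o[𝓝 0] fun x => ‖x‖ ^ m := by
  induction m with
  | zero =>
    intro f h
    simp only [pow_zero]
    rw [isLittleO_one_iff]
    have h0 : f 0 = 0 := h.2 [] (by simp)
    have := (h.1.continuousOn.continuousAt (hU.mem_nhds hU0))
    rwa [ContinuousAt, h0] at this
  | succ m ih =>
    intro f h
    have h0 : f 0 = 0 := h.2 [] (by simp)
    have hD : (fun x => ∑ i, ‖pderivE n i f x‖) =o[𝓝 0] fun x => ‖x‖ ^ m :=
      IsLittleO.fun_sum fun i _ => (ih (h.pderiv hU i)).norm_left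
    rw [isLittleO_iff]
    intro c hc
    have h1 := (isLittleO_iff.1 hD hc).and (hU.mem_nhds hU0)
    obtain ⟨r, hr, hb⟩ := Metric.eventually_nhds_iff_ball.1 h1
    filter_upwards [Metric.ball_mem_nhds _ hr] with x hx
    have hsub : ∀ y ∈ Metric.closedBall (0 : EuclideanSpace ℝ (Fin n)) ‖x‖,
        y ∈ Metric.ball (0 : EuclideanSpace ℝ (Fin n)) r := by
      intro y hy
      simp at hx hy ⊢
      linarith
    have := Convex.norm_image_sub_le_of_norm_fderiv_le (𝕜 := ℝ) (f := f) (C := c * ‖x‖ ^ m)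
      (s := Metric.closedBall 0 ‖x‖) (x := 0) (y := x)
      (fun y hy => (h.1.contDiffAt (hU.mem_nhds (hb y (hsub y hy)).2)).differentiableAt
        (by simp)) (fun y hy => ?_) (convex_closedBall _ _) (by simp) (by simp)
    · rw [h0, sub_zero, sub_zero] at this
      refine this.trans (le_of_eq ?_)
      rw [norm_pow, norm_norm]; ring
    · refine (norm_le_sum_single _).trans ((le_abs_self _).trans ((hb y (hsub y hy)).1.trans ?_))
      rw [norm_pow, norm_norm]
      gcongr
      simpa using hy

/-- Smooth functions off the origin, homogeneous of degree `-k`. -/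
def Homog {n : ℕ} (k : ℕ) (χ : EuclideanSpace ℝ (Fin n) → ℝ) : Prop :=
  (∀ x, x ≠ 0 → ContDiffAt ℝ ∞ χ x) ∧ ∀ t : ℝ, 0 < t → ∀ x, x ≠ 0 → t ^ k * χ (t • x) = χ x

lemma Homog.pderiv {n k : ℕ} {χ : EuclideanSpace ℝ (Fin n) → ℝ} (h : Homog k χ) (i : Fin n) :
    Homog (k + 1) (pderivE n i χ) := by
  refine ⟨fun x hx => ?_, fun t ht x hx => ?_⟩
  · have h1 : ContDiffAt ℝ ∞ (fderiv ℝ χ) x := (h.1 x hx).fderiv_right (m := ∞) (by simp)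
    exact h1.clm_apply (contDiffAt_const (c := EuclideanSpace.single i (1 : ℝ)))
  · have e : (fun y => t ^ k * χ (t • y)) =ᶠ[𝓝 x] χ := by
      filter_upwards [isOpen_ne.mem_nhds hx] with y hy using h.2 t ht y hy
    have e2 := e.fderiv_eq (𝕜 := ℝ)
    have hd : DifferentiableAt ℝ (fun y => χ (t • y)) x := by
      have h3 := (h.1 (t • x) (by simp [ht.ne', hx])).differentiableAt (by simp)
      exact h3.comp x (by fun_prop)
    rw [fderiv_const_mul hd, fderiv_comp_smul] at e2
    simp only [pderivE, ← e2]
    simp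
    ring

lemma Homog.bound {n k : ℕ} {χ : EuclideanSpace ℝ (Fin n) → ℝ} (h : Homog k χ) :
    ∃ C, 0 ≤ C ∧ ∀ x, x ≠ 0 → ‖x‖ ^ k * ‖χ x‖ ≤ C := by
  obtain ⟨C, hC⟩ := (isCompact_sphere (0 : EuclideanSpace ℝ (Fin n)) 1).exists_bound_of_continuousOn
    (f := χ) (fun x hx => (h.1 x (by rintro rfl; simp at hx)).continuousAt.continuousWithinAt)
  refine ⟨max C 0, le_max_right _ _, fun x hx => le_trans ?_ (le_max_left _ _)⟩
  have hx' : 0 < ‖x‖ := norm_pos_iff.2 hx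
  have e := h.2 ‖x‖ hx' (‖x‖⁻¹ • x) (by simp [hx])
  rw [smul_inv_smul₀ hx'.ne'] at e
  have := hC (‖x‖⁻¹ • x) (by simp [norm_smul, hx])
  rw [← e] at this
  simpa using this

lemma mul_isLittleO {n k j : ℕ} {χ f : EuclideanSpace ℝ (Fin n) → ℝ} (h : Homog k χ)
    (h0 : f 0 = 0) (hf : f =o[𝓝 0] fun x => ‖x‖ ^ (j + k)) :
    (fun x => χ x * f x) =o[𝓝 0] fun x => ‖x‖ ^ j := by
  obtain ⟨C, hC0, hC⟩ := h.bound
  rw [isLittleO_iff]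
  intro c hc
  have hc' : 0 < c / (C + 1) := by positivity
  filter_upwards [isLittleO_iff.1 hf hc'] with x hx
  by_cases hx0 : x = 0
  · subst hx0; rw [h0]; simp; positivity
  · rw [norm_mul]
    rw [norm_pow, norm_norm] at hx ⊢
    calc ‖χ x‖ * ‖f x‖ ≤ ‖χ x‖ * (c / (C + 1) * ‖x‖ ^ (j + k)) := by gcongr
      _ = (‖x‖ ^ k * ‖χ x‖) * (c / (C + 1) * ‖x‖ ^ j) := by ring
      _ ≤ (C + 1) * (c / (C + 1) * ‖x‖ ^ j) := by
        gcongr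
        linarith [hC x hx0]
      _ = c * ‖x‖ ^ j := by field_simp

lemma mul_contDiffOn {n : ℕ} {U : Set (EuclideanSpace ℝ (Fin n))} (hU : IsOpen U)
    (hU0 : (0 : EuclideanSpace ℝ (Fin n)) ∈ U) (m : ℕ) :
    ∀ (k : ℕ) {χ f : EuclideanSpace ℝ (Fin n) → ℝ}, Homog k χ → FlatOn U (m + k) f →
    ContDiffOn ℝ (m : ℕ∞) (fun x => χ x * f x) U := by
  induction m with
  | zero =>
    intro k χ f hχ hf
    have h0 : f 0 = 0 := hf.2 [] (by simp)
    have hc : ContinuousOn (fun x => χ x * f x) U := by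
      intro x hx
      apply ContinuousAt.continuousWithinAt
      by_cases hx0 : x = 0
      · subst hx0
        have := mul_isLittleO hχ h0 (hf.isLittleO hU hU0)
        simp only [pow_zero] at this
        rw [isLittleO_one_iff] at this
        rw [ContinuousAt, h0, mul_zero]
        exact this
      · exact (hχ.1 x hx0).continuousAt.mul (hf.1.continuousOn.continuousAt (hU.mem_nhds hx))
    simpa using hc
  | succ m ih =>
    intro k χ f hχ hf
    have h0 : f 0 = 0 := hf.2 [] (by simp)
    have hd0 : HasFDerivAt (fun x => χ x * f x) (0 : EuclideanSpace ℝ (Fin n) →L[ℝ] ℝ) 0 := by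
      have := mul_isLittleO (j := 1) hχ h0 ((hf.mono (by omega : 1 + k ≤ _)).isLittleO hU hU0)
      rw [hasFDerivAt_iff_isLittleO_nhds_zero]
      simp only [zero_add, h0, mul_zero, sub_zero, zero_apply]
      simp only [pow_one] at this
      exact this.of_norm_right
    have hdf : ∀ x ∈ U, DifferentiableAt ℝ f x := fun x hx =>
      (hf.1.contDiffAt (hU.mem_nhds hx)).differentiableAt (by norm_cast; omega)
    have hdχ : ∀ x, x ≠ 0 → DifferentiableAt ℝ χ x := fun x hx =>
      (hχ.1 x hx).differentiableAt (by simp)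
    have key : ContDiffOn ℝ ((m : ℕ∞) + 1 : ℕ∞ω) (fun x => χ x * f x) U := by
      rw [contDiffOn_succ_iff_fderiv_of_isOpen hU]
      refine ⟨fun x hx => ?_, by simp, ?_⟩
      · apply DifferentiableAt.differentiableWithinAt
        by_cases hx0 : x = 0
        · subst hx0; exact hd0.differentiableAt
        · exact (hdχ x hx0).mul (hdf x hx)
      · rw [contDiffOn_clm_apply]
        intro v
        have e : (fun x => fderiv ℝ (fun x => χ x * f x) x v) = fun x => 
            ∑ i, v i * pderivE n i (fun x => χ x * f x) x :=
          funext fun x => fderiv_apply_sum _ _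
        rw [e]
        refine ContDiffOn.sum fun i _ => contDiffOn_const.mul ?_
        have c1 := ih k hχ ((hf.mono (by omega : (m + k) + 1 ≤ _)).pderiv hU i)
        have c2 := ih (k + 1) (hχ.pderiv i) (hf.mono (by omega))
        refine (c1.add c2).congr fun x hx => ?_
        by_cases hx0 : x = 0
        · subst hx0
          have h1 : pderivE n i f 0 = 0 := hf.2 [i] (by simp; omega)
          simp [pderivE, hd0.fderiv, h0]
          right; exact h1
        · have := fderiv_mul (hdχ x hx0) (hdf x hx)
          simp only [pderivE]
          erw [this]
          simp
          ring
    refine key.of_le (le_of_eq ?_); push_cast; rfl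

/-- The conical cutoff. -/
noncomputable def cone {n : ℕ} (i : Fin n) (x : EuclideanSpace ℝ (Fin n)) : ℝ :=
  Real.smoothTransition (2 * (x i / ‖x‖))

lemma cone_homog {n : ℕ} (i : Fin n) : Homog 0 (cone i) := by
  refine ⟨fun x hx => ?_, fun t ht x hx => ?_⟩
  · refine (Real.smoothTransition.contDiffAt (n := ⊤)).comp x ?_
    refine contDiffAt_const.mul (ContDiffAt.div ?_ (contDiffAt_norm ℝ hx) (norm_ne_zero_iff.2 hx))
    exact (EuclideanSpace.proj (𝕜 := ℝ) i : EuclideanSpace ℝ (Fin n) →L[ℝ] ℝ).contDiff.contDiffAt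
  · simp only [cone, pow_zero, one_mul, norm_smul, PiLp.smul_apply, smul_eq_mul]
    rw [Real.norm_of_nonneg ht.le, mul_div_mul_left _ _ ht.ne']

/-- A morphism of sheaves `u : C^m → C^0` over an open neighborhood `U` of `0` maps the
subsheaf `𝔐^m_0` of `C^m` functions all of whose derivatives of order `≤ m` vanish at `0`
into the subsheaf `𝔐^0_0` of continuous functions vanishing at `0`. -/
theorem stmt_6 (n m : ℕ) (hn : 1 ≤ n)
    (U : Set (EuclideanSpace ℝ (Fin n))) (hU : IsOpen U) (hU0 : (0 : EuclideanSpace ℝ (Fin n)) ∈ U)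
    (u : SheafHom n m 0 U)
    (φ : EuclideanSpace ℝ (Fin n) → ℝ) (hφ : ContDiffOn ℝ (m : ℕ∞) φ U)
    (hvan : ∀ α : Fin n → ℕ, (∑ i, α i) ≤ m → partialD n α φ 0 = 0) :
    u.app U φ 0 = 0 := by
  let i : Fin n := ⟨0, hn⟩
  have hfl := flatOn_of_partialD hU hU0 hφ hvan
  have hψ : ContDiffOn ℝ (m : ℕ∞) (fun x => cone i x * φ x) U :=
    mul_contDiffOn hU hU0 m 0 (cone_homog i) hfl
  have hci : Continuous fun x : EuclideanSpace ℝ (Fin n) => x i := by fun_prop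
  have hW1 : IsOpen {x : EuclideanSpace ℝ (Fin n) | x ∈ U ∧ ‖x‖ < 2 * x i} :=
    hU.inter (isOpen_lt continuous_norm (by fun_prop))
  have hW0 : IsOpen {x : EuclideanSpace ℝ (Fin n) | x ∈ U ∧ x i < 0} :=
    hU.inter (isOpen_lt hci continuous_const)
  have e1 : ∀ x ∈ {x : EuclideanSpace ℝ (Fin n) | x ∈ U ∧ ‖x‖ < 2 * x i},
      u.app U (fun x => cone i x * φ x) x = u.app U φ x := by
    intro x hx
    have hφW := hφ.mono (fun y (hy : y ∈ {x | x ∈ U ∧ ‖x‖ < 2 * x i}) => hy.1)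
    rw [u.restrict U subset_rfl hU _ (fun y hy => hy.1) hW1 _ φ hψ hφW ?_ x hx,
      u.restrict U subset_rfl hU _ (fun y hy => hy.1) hW1 φ φ hφ hφW (fun _ _ => rfl) x hx]
    intro y hy
    have hy2 : ‖y‖ < 2 * y i := hy.2
    have hpos : 0 < ‖y‖ := by
      rw [norm_pos_iff]; rintro rfl; simp at hy2
    have : cone i y = 1 := by
      refine Real.smoothTransition.one_of_one_le ?_
      rw [← mul_div_assoc, le_div_iff₀ hpos]; linarith
    simp [this]
  have e0 : ∀ x ∈ {x : EuclideanSpace ℝ (Fin n) | x ∈ U ∧ x i < 0},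
      u.app U (fun x => cone i x * φ x) x = 0 := by
    intro x hx
    have hz : ContDiffOn ℝ (m : ℕ∞) (0 : EuclideanSpace ℝ (Fin n) → ℝ)
      {x : EuclideanSpace ℝ (Fin n) | x ∈ U ∧ x i < 0} := contDiffOn_const
    rw [u.restrict U subset_rfl hU _ (fun y hy => hy.1) hW0 _ 0 hψ hz ?_ x hx]
    · have := u.map_smul _ (fun y hy => hy.1) hW0 0 0 hz x hx
      simpa using this
    · intro y hy
      have : cone i y = 0 := by
        refine Real.smoothTransition.zero_of_nonpos ?_
        have := div_nonpos_of_nonpos_of_nonneg (le_of_lt hy.2) (norm_nonneg y)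
        linarith
      simp [this]
  have hc : Continuous fun s : ℝ => s • (EuclideanSpace.single i (1 : ℝ)) := by fun_prop
  have ht : Tendsto (fun s : ℝ => s • (EuclideanSpace.single i (1 : ℝ))) (𝓝 0) (𝓝 0) := by
    simpa using hc.tendsto 0
  have cψ := ((u.map_contDiffOn U subset_rfl hU _ hψ).continuousOn.continuousAt
    (hU.mem_nhds hU0)).tendsto.comp ht
  have cφ := ((u.map_contDiffOn U subset_rfl hU _ hφ).continuousOn.continuousAt
    (hU.mem_nhds hU0)).tendsto.comp ht
  have hmem := ht.eventually (hU.mem_nhds hU0)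
  have z1 : u.app U (fun x => cone i x * φ x) 0 = u.app U φ 0 := by
    refine tendsto_nhds_unique_of_eventuallyEq (l := 𝓝[>] (0 : ℝ))
      (cψ.mono_left nhdsWithin_le_nhds) (cφ.mono_left nhdsWithin_le_nhds) ?_
    filter_upwards [self_mem_nhdsWithin, nhdsWithin_le_nhds hmem] with s hs hsU
    have hs' : (0 : ℝ) < s := hs
    refine e1 _ ⟨hsU, ?_⟩
    simp [norm_smul, abs_of_pos hs']
    linarith
  have z0 : u.app U (fun x => cone i x * φ x) 0 = 0 := by
    refine tendsto_nhds_unique_of_eventuallyEq (l := 𝓝[<] (0 : ℝ))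
      (cψ.mono_left nhdsWithin_le_nhds) (tendsto_const_nhds (x := (0 : ℝ))) ?_
    filter_upwards [self_mem_nhdsWithin, nhdsWithin_le_nhds hmem] with s hs hsU
    have hs' : s < (0 : ℝ) := hs
    refine e0 _ ⟨hsU, ?_⟩
    simpa using hs'
  rw [← z1, z0]
end

section
/- Let n ≥ 1, let m be a natural number, let U be an open subset of ℝⁿ, and for each multi-index α with |α| ≤ m let a_α : U → ℝ be a continuous function. Suppose that the operator P(φ)(x) = Σ_{|α| ≤ m} a_α(x) · (∂^α φ)(x) maps C^m(U) into C^m(U), i.e. for every φ ∈ C^m(U) the function Pφ is of class C^m on U. Then a_0 (the coefficient of the zero multi-index) is of class C^m on U, and a_α = 0 identically on U for every multi-index α with |α| ≥ 1. -/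
open scoped BigOperators

open Filter Topology in
theorem aux_littleO {m : ℕ} {h : ℝ → ℝ} {δ : ℝ} (hδ : 0 < δ)
    (hh : ContDiffOn ℝ m h (Set.Ioo (-δ) δ)) (h0 : ∀ t ∈ Set.Ioo (-δ) δ, t ≤ 0 → h t = 0) :
    h =o[𝓝 0] fun t => t ^ m := by
  have hmem : (0 : ℝ) ∈ Set.Ioo (-δ) δ := ⟨by linarith, hδ⟩
  have key : ∀ k ≤ m, iteratedDerivWithin k h (Set.Ioo (-δ) δ) 0 = 0 := by
    intro k hk
    have hc : ContinuousOn (iteratedDerivWithin k h (Set.Ioo (-δ) δ)) (Set.Ioo (-δ) δ) :=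
      hh.continuousOn_iteratedDerivWithin (by exact_mod_cast hk) (isOpen_Ioo.uniqueDiffOn)
    have hca : ContinuousAt (iteratedDerivWithin k h (Set.Ioo (-δ) δ)) 0 :=
      hc.continuousAt (isOpen_Ioo.mem_nhds hmem)
    have h1 : Tendsto (iteratedDerivWithin k h (Set.Ioo (-δ) δ)) (𝓝[<] 0)
      (𝓝 (iteratedDerivWithin k h (Set.Ioo (-δ) δ) 0)) := hca.tendsto.mono_left nhdsWithin_le_nhds
    have h2 : Tendsto (iteratedDerivWithin k h (Set.Ioo (-δ) δ)) (𝓝[<] 0) (𝓝 0) := by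
      refine tendsto_const_nhds.congr' ?_
      have : Set.Ioo (-δ) 0 ∈ 𝓝[<] (0:ℝ) := Ioo_mem_nhdsLT (by linarith)
      filter_upwards [this] with t ht
      have hEq : h =ᶠ[𝓝[Set.Ioo (-δ) δ] t] fun _ => (0:ℝ) := by
        apply Filter.Eventually.filter_mono nhdsWithin_le_nhds
        filter_upwards [isOpen_Ioo.mem_nhds ht] with s hs
        exact h0 s ⟨hs.1, by linarith [hs.2]⟩ hs.2.le
      rw [hEq.iteratedDerivWithin_eq (h0 t ⟨ht.1, by linarith [ht.2]⟩ ht.2.le)]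
      simp [iteratedDerivWithin]
    exact tendsto_nhds_unique h1 h2
  have := taylor_isLittleO (convex_Ioo (-δ) δ) hmem hh
  rw [isOpen_Ioo.nhdsWithin_eq hmem] at this
  simp only [taylor_within_apply, sub_zero] at this
  refine this.congr_left ?_
  intro t
  rw [Finset.sum_eq_zero, sub_zero]
  intro k hk
  rw [key k (by simpa [Nat.lt_succ_iff] using hk), smul_zero]

noncomputable def posPow (k : ℕ) (t : ℝ) : ℝ := (max t 0) ^ k / (k.factorial : ℝ)

theorem posPow_continuous (k : ℕ) : Continuous (posPow k) := by
  unfold posPow; fun_prop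

theorem posPow_nonpos {k : ℕ} {t : ℝ} (ht : t ≤ 0) : posPow (k + 1) t = 0 := by
  simp [posPow, max_eq_right ht]

theorem posPow_pos {k : ℕ} {t : ℝ} (ht : 0 ≤ t) : posPow k t = t ^ k / (k.factorial : ℝ) := by
  simp [posPow, max_eq_left ht]

open Topology in
theorem posPow_hasDerivAt_s9 (k : ℕ) (t : ℝ) :
    HasDerivAt (posPow (k + 2)) (posPow (k + 1) t) t := by
  refine hasDerivAt_of_hasDerivAt_of_ne' (x := 0) ?_ (posPow_continuous _).continuousAt
    (posPow_continuous _).continuousAt t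
  intro y hy
  rcases lt_or_gt_of_ne hy with hy | hy
  · rw [posPow_nonpos hy.le]
    refine (hasDerivAt_const y (0:ℝ)).congr_of_eventuallyEq ?_
    filter_upwards [gt_mem_nhds hy] with s hs
    exact posPow_nonpos (le_of_lt hs)
  · rw [posPow_pos hy.le]
    have h1 : HasDerivAt (fun s : ℝ => s ^ (k + 2) / ((k + 2).factorial : ℝ))
        (((k + 2 : ℕ) : ℝ) * y ^ (k + 1) / ((k + 2).factorial : ℝ)) y :=
      (hasDerivAt_pow (k + 2) y).div_const _
    have h2 : ((k + 2 : ℕ) : ℝ) * y ^ (k + 1) / ((k + 2).factorial : ℝ)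
        = y ^ (k + 1) / ((k + 1).factorial : ℝ) := by
      rw [Nat.factorial_succ (k + 1)]
      have : ((k + 1).factorial : ℝ) ≠ 0 := by positivity
      push_cast
      have h3 : ((k:ℝ) + 1 + 1) ≠ 0 := by positivity
      field_simp
      ring
    rw [h2] at h1
    refine h1.congr_of_eventuallyEq ?_
    filter_upwards [lt_mem_nhds hy] with s hs
    exact posPow_pos (le_of_lt hs)

theorem posPow_contDiff_s9 (m : ℕ) : ContDiff ℝ m (posPow (m + 1)) := by
  induction m with
  | zero => exact contDiff_zero.2 (posPow_continuous _)
  | succ m ih =>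
    push_cast
    rw [contDiff_succ_iff_deriv]
    refine ⟨fun t => (posPow_hasDerivAt_s9 m t).differentiableAt, by simp, ?_⟩
    have : deriv (posPow (m + 1 + 1)) = posPow (m + 1) :=
      funext fun t => (posPow_hasDerivAt_s9 m t).deriv
    rw [this]; exact ih

/-- The ridge test function. -/
noncomputable def ridge {n : ℕ} (ξ x₀ : EuclideanSpace ℝ (Fin n)) (k : ℕ)
    (x : EuclideanSpace ℝ (Fin n)) : ℝ := posPow k (inner ℝ ξ (x - x₀))

theorem ridge_pderivE {n : ℕ} (ξ x₀ : EuclideanSpace ℝ (Fin n)) (k : ℕ) (c : ℝ) (i : Fin n) :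
    pderivE n i (fun x => c * ridge ξ x₀ (k + 2) x)
      = fun x => (c * ξ i) * ridge ξ x₀ (k + 1) x := by
  funext x
  have h1 : HasFDerivAt (fun y : EuclideanSpace ℝ (Fin n) => (innerSL ℝ ξ) (y - x₀))
      (innerSL ℝ ξ) x := by
    have h0 := (innerSL ℝ ξ).hasFDerivAt.comp x ((hasFDerivAt_id x).sub_const x₀)
    rw [ContinuousLinearMap.comp_id] at h0
    exact h0
  have h2 := ((posPow_hasDerivAt_s9 k ((innerSL ℝ ξ) (x - x₀))).comp_hasFDerivAt x h1).const_mul c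
  have h3 : HasFDerivAt (fun x => c * ridge ξ x₀ (k + 2) x)
    (c • (posPow (k + 1) ((innerSL ℝ ξ) (x - x₀)) • innerSL ℝ ξ)) x := h2
  unfold pderivE
  rw [h3.fderiv]
  simp [ridge, EuclideanSpace.inner_single_right]
  ring

theorem ridge_iter {n : ℕ} (ξ x₀ : EuclideanSpace ℝ (Fin n)) (i : Fin n) (r : ℕ) :
    ∀ (k : ℕ) (c : ℝ), (pderivE n i)^[r] (fun x => c * ridge ξ x₀ (k + 1 + r) x)
      = fun x => (c * ξ i ^ r) * ridge ξ x₀ (k + 1) x := by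
  induction r with
  | zero => intro k c; simp
  | succ r ih =>
    intro k c
    rw [Function.iterate_succ_apply]
    have : k + 1 + (r + 1) = (k + r) + 2 := by ring
    rw [this, ridge_pderivE]
    have h2 : k + r + 1 = k + 1 + r := by ring
    rw [h2, ih]
    funext x; ring

theorem ridge_foldr {n : ℕ} (ξ x₀ : EuclideanSpace ℝ (Fin n)) (α : Fin n → ℕ)
    (l : List (Fin n)) : ∀ (k : ℕ),
    l.foldr (fun i g => (pderivE n i)^[α i] g) (fun x => ridge ξ x₀ (k + 1 + (l.map α).sum) x)
      = fun x => (l.map fun i => ξ i ^ α i).prod * ridge ξ x₀ (k + 1) x := by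
  induction l with
  | nil => intro k; simp
  | cons i l ih =>
    intro k
    simp only [List.foldr_cons, List.map_cons, List.sum_cons, List.prod_cons]
    have : k + 1 + (α i + (l.map α).sum) = (k + α i) + 1 + (l.map α).sum := by ring
    rw [this, ih]
    have h2 : k + α i + 1 = k + 1 + α i := by ring
    rw [h2, ridge_iter]
    funext x; ring

theorem ridge_partialD {n m : ℕ} (ξ x₀ : EuclideanSpace ℝ (Fin n)) (α : Fin n → ℕ)
    (hα : ∑ i, α i ≤ m) :
    partialD n α (ridge ξ x₀ (m + 1))
      = fun x => (∏ i, ξ i ^ α i) * ridge ξ x₀ (m + 1 - ∑ i, α i) x := by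
  have hs : ((List.finRange n).map α).sum = ∑ i, α i := by
    rw [Fin.sum_univ_def]
  have hp : ((List.finRange n).map fun i => ξ i ^ α i).prod = ∏ i, ξ i ^ α i := by
    rw [Fin.prod_univ_def]
  have := ridge_foldr ξ x₀ α (List.finRange n) (m - ∑ i, α i)
  rw [hs, hp] at this
  have e1 : m - ∑ i, α i + 1 + ∑ i, α i = m + 1 := by omega
  have e2 : m - ∑ i, α i + 1 = m + 1 - ∑ i, α i := by omega
  rw [e1, e2] at this
  exact this

theorem ridge_contDiff {n : ℕ} (ξ x₀ : EuclideanSpace ℝ (Fin n)) (m : ℕ) :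
    ContDiff ℝ m (ridge ξ x₀ (m + 1)) := by
  refine (posPow_contDiff_s9 m).comp (f := fun x => inner ℝ ξ (x - x₀)) ?_
  exact contDiff_const.inner ℝ (contDiff_id.sub contDiff_const)

/-- Symbol of degree `j`. -/
noncomputable def symb {n : ℕ} (m : ℕ) (a : (Fin n → ℕ) → EuclideanSpace ℝ (Fin n) → ℝ)
    (ξ : EuclideanSpace ℝ (Fin n)) (j : ℕ) (x : EuclideanSpace ℝ (Fin n)) : ℝ :=
  ∑ α ∈ multiIdx n m with ∑ i, α i = j, a α x * ∏ i, ξ i ^ α i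

theorem ridge_op {n m : ℕ} (a : (Fin n → ℕ) → EuclideanSpace ℝ (Fin n) → ℝ)
    (ξ x₀ x : EuclideanSpace ℝ (Fin n)) :
    ∑ α ∈ multiIdx n m, a α x * partialD n α (ridge ξ x₀ (m + 1)) x
      = ∑ j ∈ Finset.range (m + 1), symb m a ξ j x * ridge ξ x₀ (m + 1 - j) x := by
  have hm : ∀ α ∈ multiIdx n m, ∑ i, α i ≤ m := fun α h => (Finset.mem_filter.1 h).2
  rw [← Finset.sum_fiberwise_of_maps_to (s := multiIdx n m) (t := Finset.range (m + 1))
    (g := fun α => ∑ i, α i) (fun α h => by simpa [Nat.lt_succ_iff] using hm α h)]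
  refine Finset.sum_congr rfl fun j _ => ?_
  rw [symb, Finset.sum_mul]
  refine Finset.sum_congr rfl fun α h => ?_
  rw [Finset.mem_filter] at h
  rw [ridge_partialD ξ x₀ α (hm α h.1), h.2]
  ring

open Filter Topology in
theorem symb_zero {n m : ℕ} (U : Set (EuclideanSpace ℝ (Fin n))) (hU : IsOpen U)
    (a : (Fin n → ℕ) → EuclideanSpace ℝ (Fin n) → ℝ)
    (ha : ∀ α ∈ multiIdx n m, ContinuousOn (a α) U)
    (hP : ∀ φ : EuclideanSpace ℝ (Fin n) → ℝ, ContDiffOn ℝ (m : ℕ∞) φ U →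
      ContDiffOn ℝ (m : ℕ∞)
        (fun x => ∑ α ∈ multiIdx n m, a α x * partialD n α φ x) U)
    (ξ : EuclideanSpace ℝ (Fin n)) (hξ : ξ ≠ 0) (j : ℕ) (hj : 1 ≤ j) (hjm : j ≤ m)
    (ih : ∀ i, j < i → i ≤ m → ∀ x ∈ U, symb m a ξ i x = 0)
    (x₀ : EuclideanSpace ℝ (Fin n)) (hx₀ : x₀ ∈ U) : symb m a ξ j x₀ = 0 := by
  have hS : ∀ i, ContinuousOn (symb m a ξ i) U := by
    intro i
    unfold symb
    refine continuousOn_finsetSum _ fun α h => ?_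
    exact (ha α (Finset.mem_filter.1 h).1).mul continuousOn_const
  set γ : ℝ → EuclideanSpace ℝ (Fin n) := fun t => x₀ + t • ξ with hγ
  have hγc : Continuous γ := by fun_prop
  have hγ0 : γ 0 = x₀ := by simp [hγ]
  have hopen : γ ⁻¹' U ∈ 𝓝 (0:ℝ) := hγc.continuousAt.preimage_mem_nhds (by
    rw [hγ0]; exact hU.mem_nhds hx₀)
  obtain ⟨δ, hδ, hball⟩ := Metric.mem_nhds_iff.1 hopen
  rw [Real.ball_eq_Ioo, zero_sub, zero_add] at hball
  set c : ℝ := inner ℝ ξ ξ with hc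
  have hcpos : 0 < c := real_inner_self_pos.2 hξ
  have hridge : ∀ k t, ridge ξ x₀ k (γ t) = posPow k (t * c) := by
    intro k t; simp [ridge, hγ, inner_smul_right, hc]
  have hφ := hP (ridge ξ x₀ (m + 1)) (by exact_mod_cast (ridge_contDiff ξ x₀ m).contDiffOn)
  simp only [ridge_op] at hφ
  set h : ℝ → ℝ := fun t => ∑ i ∈ Finset.range (m + 1),
    symb m a ξ i (γ t) * posPow (m + 1 - i) (t * c) with hh
  have hcd : ContDiffOn ℝ m h (Set.Ioo (-δ) δ) := by
    have := ContDiffOn.comp (g := _) (f := γ) (s := Set.Ioo (-δ) δ) hφ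
      (by apply ContDiff.contDiffOn; fun_prop) hball
    have h2 := this.congr (f₁ := h) (fun t _ => by simp [hh, hridge])
    exact_mod_cast h2
  have hzero : ∀ t ∈ Set.Ioo (-δ) δ, t ≤ 0 → h t = 0 := by
    intro t _ ht
    refine Finset.sum_eq_zero fun i hi => ?_
    have : m + 1 - i = (m - i) + 1 := by
      have := Finset.mem_range.1 hi; omega
    rw [this, posPow_nonpos (mul_nonpos_of_nonpos_of_nonneg ht hcpos.le), mul_zero]
  have hO := aux_littleO hδ hcd hzero
  have hO2 : h =o[𝓝[>] 0] fun t => t ^ (m + 1 - j) := by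
    refine (hO.mono nhdsWithin_le_nhds).trans_isBigO ?_
    refine Asymptotics.IsBigO.mono ?_ nhdsWithin_le_nhds
    refine Asymptotics.IsBigO.of_bound 1 ?_
    filter_upwards [Metric.ball_mem_nhds (0:ℝ) one_pos] with t ht
    rw [one_mul, norm_pow, norm_pow]
    exact pow_le_pow_of_le_one (norm_nonneg t) (mem_ball_zero_iff.1 ht).le (by omega)
  have hlim0 : Tendsto (fun t => h t / t ^ (m + 1 - j)) (𝓝[>] 0) (𝓝 0) :=
    hO2.tendsto_div_nhds_zero
  have hSt : ∀ i, Tendsto (fun t => symb m a ξ i (γ t)) (𝓝[>] 0) (𝓝 (symb m a ξ i x₀)) := by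
    intro i
    have h1 : ContinuousAt (symb m a ξ i) (γ 0) := by
      rw [hγ0]; exact (hS i).continuousAt (hU.mem_nhds hx₀)
    have h2 : ContinuousAt (fun t => symb m a ξ i (γ t)) 0 :=
      ContinuousAt.comp (f := γ) h1 hγc.continuousAt
    have := h2.tendsto
    rw [hγ0] at this
    exact this.mono_left nhdsWithin_le_nhds
  have hlim1 : Tendsto (fun t => ∑ i ∈ Finset.range (j + 1),
      symb m a ξ i (γ t) * (t ^ (j - i) * (c ^ (m + 1 - i) / ((m + 1 - i).factorial : ℝ))))
      (𝓝[>] 0) (𝓝 (∑ i ∈ Finset.range (j + 1), symb m a ξ i x₀ *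
        ((0:ℝ) ^ (j - i) * (c ^ (m + 1 - i) / ((m + 1 - i).factorial : ℝ))))) := by
    refine tendsto_finsetSum _ fun i _ => (hSt i).mul ?_
    refine Tendsto.mul_const _ ?_
    have : ContinuousAt (fun t : ℝ => t ^ (j - i)) 0 := by fun_prop
    exact this.tendsto.mono_left nhdsWithin_le_nhds
  have hcongr : (fun t => h t / t ^ (m + 1 - j)) =ᶠ[𝓝[>] 0] fun t =>
      ∑ i ∈ Finset.range (j + 1),
      symb m a ξ i (γ t) * (t ^ (j - i) * (c ^ (m + 1 - i) / ((m + 1 - i).factorial : ℝ))) := by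
    filter_upwards [Ioo_mem_nhdsGT hδ] with t ht
    have htU : γ t ∈ U := hball ⟨by linarith [ht.1], ht.2⟩
    have hsub : Finset.range (j + 1) ⊆ Finset.range (m + 1) :=
      Finset.range_subset_range.2 (by omega)
    have e1 : h t = ∑ i ∈ Finset.range (j + 1),
        symb m a ξ i (γ t) * posPow (m + 1 - i) (t * c) := by
      refine (Finset.sum_subset hsub fun i hi hi' => ?_).symm
      simp only [Finset.mem_range] at hi hi'
      rw [ih i (by omega) (by omega) _ htU, zero_mul]
    rw [e1, Finset.sum_div]
    refine Finset.sum_congr rfl fun i hi => ?_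
    have hi := Finset.mem_range.1 hi
    rw [posPow_pos (mul_nonneg ht.1.le hcpos.le), mul_pow]
    have e2 : m + 1 - i = (j - i) + (m + 1 - j) := by omega
    have e3 : t ^ (m + 1 - i) = t ^ (j - i) * t ^ (m + 1 - j) := by rw [← pow_add, ← e2]
    rw [e3]
    have : t ^ (m + 1 - j) ≠ 0 := pow_ne_zero _ ht.1.ne'
    field_simp
  have heq := tendsto_nhds_unique hlim0 (hlim1.congr' hcongr.symm)
  rw [Finset.sum_range_succ, Finset.sum_eq_zero, zero_add] at heq
  · simp only [Nat.sub_self, pow_zero, one_mul] at heq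
    have : c ^ (m + 1 - j) / ((m + 1 - j).factorial : ℝ) ≠ 0 := by positivity
    exact (mul_eq_zero.1 heq.symm).resolve_right this
  · intro i hi
    have hi := Finset.mem_range.1 hi
    rw [zero_pow (by omega)]; ring

/-- If a differential operator `P = ∑_{|α| ≤ m} a_α ∂^α` with continuous coefficients maps
`C^m(U)` into `C^m(U)`, then `a_0` is of class `C^m` on `U` and `a_α = 0` on `U` for every
multi-index `α` with `|α| ≥ 1`. -/
theorem stmt_9 (n m : ℕ) (hn : 1 ≤ n)
    (U : Set (EuclideanSpace ℝ (Fin n))) (hU : IsOpen U)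
    (a : (Fin n → ℕ) → EuclideanSpace ℝ (Fin n) → ℝ)
    (ha : ∀ α ∈ multiIdx n m, ContinuousOn (a α) U)
    (hP : ∀ φ : EuclideanSpace ℝ (Fin n) → ℝ, ContDiffOn ℝ (m : ℕ∞) φ U →
      ContDiffOn ℝ (m : ℕ∞)
        (fun x => ∑ α ∈ multiIdx n m, a α x * partialD n α φ x) U) :
    ContDiffOn ℝ (m : ℕ∞) (a fun _ => 0) U ∧
    ∀ α ∈ multiIdx n m, 1 ≤ ∑ i, α i → ∀ x ∈ U, a α x = 0 := by
  have hz : ∀ α ∈ multiIdx n m, 1 ≤ ∑ i, α i → ∀ x ∈ U, a α x = 0 := by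
    have hs : ∀ ξ : EuclideanSpace ℝ (Fin n), ξ ≠ 0 → ∀ d j, 1 ≤ j → j ≤ m → m - j ≤ d →
        ∀ x ∈ U, symb m a ξ j x = 0 := by
      intro ξ hξ d
      induction d with
      | zero =>
        intro j h1 h2 h3 x hx
        exact symb_zero U hU a ha hP ξ hξ j h1 h2 (fun i _ _ => by omega) x hx
      | succ d ih =>
        intro j h1 h2 h3 x hx
        exact symb_zero U hU a ha hP ξ hξ j h1 h2
          (fun i hi hi' => ih i (by omega) hi' (by omega)) x hx
    intro α hα h1 x hx
    have hαm : ∑ i, α i ≤ m := (Finset.mem_filter.1 hα).2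
    let p : MvPolynomial (Fin n) ℝ :=
      ∑ β ∈ multiIdx n m with ∑ i, β i = ∑ i, α i,
        MvPolynomial.monomial (Finsupp.equivFunOnFinite.symm β) (a β x)
    have hp : p = 0 := by
      apply MvPolynomial.funext
      intro ξ
      have e : MvPolynomial.eval ξ p = symb m a (WithLp.toLp 2 ξ) (∑ i, α i) x := by
        simp only [p, map_sum, symb, MvPolynomial.eval_monomial]
        refine Finset.sum_congr rfl fun β _ => ?_
        rw [Finsupp.prod_fintype _ _ (fun i => by simp)]
        simp
      rw [e, map_zero]
      by_cases h0 : WithLp.toLp 2 ξ = (0 : EuclideanSpace ℝ (Fin n))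
      · rw [h0, symb]
        refine Finset.sum_eq_zero fun β hβ => ?_
        have hβ := (Finset.mem_filter.1 hβ).2
        obtain ⟨i, hi⟩ : ∃ i, β i ≠ 0 := by
          by_contra hcon
          push Not at hcon
          simp [hcon] at hβ
          omega
        rw [Finset.prod_eq_zero (Finset.mem_univ i) (by simp [hi]), mul_zero]
      · exact hs _ h0 m _ h1 hαm (by omega) x hx
    have hcoef : p.coeff (Finsupp.equivFunOnFinite.symm α) = a α x := by
      simp only [p, MvPolynomial.coeff_sum, MvPolynomial.coeff_monomial,
        EmbeddingLike.apply_eq_iff_eq]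
      rw [Finset.sum_ite_eq' , if_pos (by simp [hα])]
    rw [← hcoef, hp, MvPolynomial.coeff_zero]
  refine ⟨?_, hz⟩
  have h1 := hP (fun _ => 1) contDiffOn_const
  refine h1.congr fun x hx => ?_
  have h0 : (fun _ => 0 : Fin n → ℕ) ∈ multiIdx n m := by
    simp [multiIdx, Pi.le_def]
  rw [Finset.sum_eq_single_of_mem _ h0]
  · have : ∀ l : List (Fin n), l.foldr (fun i g => (pderivE n i)^[0] g)
        (fun _ : EuclideanSpace ℝ (Fin n) => (1:ℝ)) = fun _ => 1 := by
      intro l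
      induction l with
      | nil => rfl
      | cons i l ih => rw [List.foldr_cons, ih]; rfl
    have h2 : partialD n (fun _ => 0) (fun _ => 1) = fun _ => 1 := this _
    rw [h2, mul_one]
  · intro β hβ hne
    rw [hz β hβ ?_ x hx, zero_mul]
    by_contra hcon
    apply hne
    have : ∑ i, β i = 0 := by omega
    funext i
    exact (Finset.sum_eq_zero_iff.1 this) i (Finset.mem_univ i)
end
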